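/- arXiv:2312.03295 — 7 statements merged into one kernel-verified Lean document; each statement's English description precedes it below -/
import Mathlib

section
/- Let ε > 0 and let h : ℝ → ℝ be twice differentiable. Define u(x,y) = h(x)·exp(-y/ε). Then for all (x,y) ∈ ℝ², -ε·(∂²u/∂x² + ∂²u/∂y²)(x,y) - ∂u/∂y(x,y) = -ε·h''(x)·exp(-y/ε). In particular, applying the convection–diffusion operator to the boundary-layer ansatz produces a residual with no negative powers of ε: the stiff terms of order 1/ε and 1/ε² cancel exactly. -/
open Real

/-- The first derivative of a multiple of the corrector profile `exp (-y / ε)`. -/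
theorem deriv_const_mul_exp_neg_div (c ε : ℝ) :
    deriv (fun y : ℝ => c * Real.exp (-y / ε)) = fun y => -c / ε * Real.exp (-y / ε) := by
  funext y
  have hexp : HasDerivAt (fun y : ℝ => Real.exp (-y / ε)) (Real.exp (-y / ε) * (-1 / ε)) y :=
    ((hasDerivAt_id y).neg.div_const ε).exp
  rw [(hexp.const_mul c).deriv]
  ring

/-- Applying the convection–diffusion operator
`L_ε u = -ε(∂²_x u + ∂²_y u) - ∂_y u` to the boundary-layer ansatz
`u(x,y) = h(x)·exp(-y/ε)` gives the residual `-ε·h''(x)·exp(-y/ε)`: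
the stiff terms of order `1/ε` and `1/ε²` cancel exactly. -/
theorem stmt2 (ε : ℝ) (hε : 0 < ε) (h : ℝ → ℝ)
    (hh : ∀ x : ℝ, DifferentiableAt ℝ h x)
    (hh' : ∀ x : ℝ, DifferentiableAt ℝ (deriv h) x)
    (u : ℝ → ℝ → ℝ) (hu : ∀ x y : ℝ, u x y = h x * Real.exp (-y / ε)) :
    ∀ x y : ℝ,
      -ε * (deriv (deriv (fun x' => u x' y)) x + deriv (deriv (fun y' => u x y')) y)
          - deriv (fun y' => u x y') y
        = -ε * deriv (deriv h) x * Real.exp (-y / ε) := by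
  intro x y
  simp only [hu, deriv_mul_const_field', deriv_const_mul_exp_neg_div]
  field_simp
  ring
end

section
/- Let A > 0 and R > 0. There exists a constant C > 0, depending only on A and R, such that for every ε ∈ (0,1], ∫_π^{2π} ∫_0^R (η/ε)·cos²(τ)·exp(A·sin(τ)·η/ε) dη dτ ≤ C. -/
open Real

/-- The integrand differs from the derivative of `cos τ * exp (k * sin τ)` by
`sin τ * exp (k * sin τ)`, which is nonpositive on `[π, 2π]`. -/
theorem integral_mul_cos_sq_mul_exp_mul_sin_le_two (k : ℝ) :
    ∫ τ in π..(2 * π), k * cos τ ^ 2 * exp (k * sin τ) ≤ 2 := by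
  have hderiv (τ : ℝ) : HasDerivAt (fun τ => cos τ * exp (k * sin τ))
      (k * cos τ ^ 2 * exp (k * sin τ) - sin τ * exp (k * sin τ)) τ :=
    ((hasDerivAt_cos τ).mul ((hasDerivAt_sin τ).const_mul k).exp).congr_deriv (by ring)
  have hint : ∫ τ in π..(2 * π),
      (k * cos τ ^ 2 * exp (k * sin τ) - sin τ * exp (k * sin τ)) = 2 := by
    rw [intervalIntegral.integral_eq_sub_of_hasDerivAt (fun τ _ => hderiv τ)
      (Continuous.intervalIntegrable (by fun_prop) _ _)]
    norm_num
  refine le_of_le_of_eq (intervalIntegral.integral_mono_on (by linarith [pi_pos])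
    (Continuous.intervalIntegrable (by fun_prop) _ _)
    (Continuous.intervalIntegrable (by fun_prop) _ _) fun τ hτ => ?_) hint
  have hsin : sin τ ≤ 0 := by
    rw [← sin_sub_two_pi]
    exact sin_nonpos_of_nonpos_of_neg_pi_le (by linarith [hτ.2]) (by linarith [hτ.1])
  linarith [mul_nonpos_of_nonpos_of_nonneg hsin (exp_pos (k * sin τ)).le]

/-- uniform `L¹` bound for the dominant `O(ε⁻¹)` part of the
SL-PINN residual: for fixed `A, R > 0` there is `C > 0` with
`∫_π^{2π} ∫_0^R (η/ε)·cos²τ·exp(A·sin(τ)·η/ε) dη dτ ≤ C` for all `ε ∈ (0,1]`. -/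
theorem stmt5 (A R : ℝ) (hA : 0 < A) (hR : 0 < R) :
    ∃ C > (0 : ℝ), ∀ ε ∈ Set.Ioc (0 : ℝ) 1,
      (∫ τ in π..(2 * π), ∫ η in (0 : ℝ)..R,
          (η / ε) * (Real.cos τ) ^ 2 * Real.exp (A * Real.sin τ * η / ε)) ≤ C := by
  refine ⟨R * (2 / A), by positivity, fun ε _ => ?_⟩
  have hcont : Continuous (Function.uncurry fun τ η : ℝ =>
      (η / ε) * cos τ ^ 2 * exp (A * sin τ * η / ε)) := by
    unfold Function.uncurry
    fun_prop
  rw [MeasureTheory.intervalIntegral_intervalIntegral_swap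
    ((hcont.continuousOn.integrableOn_compact (isCompact_uIcc.prod isCompact_uIcc)).mono_set
      (Set.prod_mono Set.uIoc_subset_uIcc Set.uIoc_subset_uIcc))]
  have hinner (η : ℝ) : ∫ τ in π..(2 * π),
      (η / ε) * cos τ ^ 2 * exp (A * sin τ * η / ε) ≤ 2 / A := by
    rw [le_div_iff₀' hA, ← intervalIntegral.integral_const_mul]
    refine le_of_eq_of_le (intervalIntegral.integral_congr fun τ _ => ?_)
      (integral_mul_cos_sq_mul_exp_mul_sin_le_two (A * η / ε))
    simp only [show A * sin τ * η / ε = A * η / ε * sin τ by ring]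
    ring
  calc _ ≤ ∫ _ in (0 : ℝ)..R, 2 / A :=
        intervalIntegral.integral_mono_on hR.le
          (Continuous.intervalIntegrable
            (intervalIntegral.continuous_parametric_intervalIntegral_of_continuous' (by
              unfold Function.uncurry
              fun_prop) _ _) _ _)
          intervalIntegrable_const fun η _ => hinner η
    _ = R * (2 / A) := by rw [intervalIntegral.integral_const, sub_zero, smul_eq_mul]
end

section
/- Let Ω = {(x,y) : x² + y² < 1} and let f be smooth on the closed disk, satisfying the compatibility conditions ∂^{p₁+p₂}f/∂x^{p₁}∂y^{p₂}(±1, 0) = 0 for all integers p₁, p₂ ≥ 0 with 0 ≤ 2p₁ + p₂ ≤ 2. Define u⁰(x,y) = ∫_y^{√(1-x²)} f(x,s) ds. Fix a smooth cutoff δ : [0,1] → [0,1] with δ(η) = 1 for η ∈ [0,1/2] and δ(η) = 0 for η ∈ [3/4,1]. For ε > 0 define, using the boundary-fitted coordinates x = (1-η)cos τ, y = (1-η)sin τ (0 ≤ η < 1, τ ∈ [0,2π]), the approximate corrector φ̄⁰(x,y) = -u⁰(cos τ, sin τ)·exp(sin(τ)·η/ε)·χ_{[π,2π]}(τ)·δ(η).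 Then there exists a constant κ > 0, independent of ε, such that for every ε ∈ (0,1] and every classical solution u^ε ∈ C²(Ω) ∩ C(Ω̄) of -εΔu^ε - ∂_y u^ε = f in Ω with u^ε = 0 on ∂Ω, one has ‖u^ε - u⁰ - φ̄⁰‖_{L²(Ω)} + √ε·‖u^ε - u⁰ - φ̄⁰‖_{H¹(Ω)} ≤ κ·√ε. -/
open Real MeasureTheory Set

/-- First partial derivative (in the `x`-direction) of a function on `ℝ × ℝ`. -/
noncomputable def partialX (w : ℝ × ℝ → ℝ) (p : ℝ × ℝ) : ℝ :=
  deriv (fun x => w (x, p.2)) p.1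

/-- Second partial derivative (in the `y`-direction) of a function on `ℝ × ℝ`. -/
noncomputable def partialY (w : ℝ × ℝ → ℝ) (p : ℝ × ℝ) : ℝ :=
  deriv (fun y => w (p.1, y)) p.2

/-- `L²` norm of `w` on a set `Ω ⊆ ℝ²`. -/
noncomputable def L2norm (w : ℝ × ℝ → ℝ) (Ω : Set (ℝ × ℝ)) : ℝ :=
  (∫ p in Ω, (w p) ^ 2) ^ (1 / 2 : ℝ)

/-- `H¹` norm of `w` on a set `Ω ⊆ ℝ²`: `‖w‖²_{H¹} = ∫_Ω (w² + |∇w|²)`. -/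
noncomputable def H1norm (w : ℝ × ℝ → ℝ) (Ω : Set (ℝ × ℝ)) : ℝ :=
  (∫ p in Ω, (w p) ^ 2 + (partialX w p) ^ 2 + (partialY w p) ^ 2) ^ (1 / 2 : ℝ)

/-- `w` is differentiable at `p` with gradient `(a, b)`. -/
def HasGrad (w : ℝ × ℝ → ℝ) (p : ℝ × ℝ) (a b : ℝ) : Prop :=
  HasFDerivAt w (a • ContinuousLinearMap.fst ℝ ℝ ℝ + b • ContinuousLinearMap.snd ℝ ℝ ℝ) p

namespace HasGrad

variable {v w : ℝ × ℝ → ℝ} {p : ℝ × ℝ} {a b c d : ℝ}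

theorem congr_grad (h : HasGrad w p a b) (ha : a = c) (hb : b = d) : HasGrad w p c d := by
  subst ha hb; exact h

theorem of_hasFDerivAt {l : ℝ × ℝ →L[ℝ] ℝ} (h : HasFDerivAt w l p) :
    HasGrad w p (l (1, 0)) (l (0, 1)) := by
  unfold HasGrad
  convert h using 1
  ext <;> simp

theorem const (k : ℝ) : HasGrad (fun _ => k) p 0 0 := by
  simpa [HasGrad] using hasFDerivAt_const k p

theorem fst : HasGrad (fun q => q.1) p 1 0 := by
  simpa [HasGrad] using hasFDerivAt_fst (𝕜 := ℝ) (p := p)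

theorem snd : HasGrad (fun q => q.2) p 0 1 := by
  simpa [HasGrad] using hasFDerivAt_snd (𝕜 := ℝ) (p := p)

theorem add (hv : HasGrad v p a b) (hw : HasGrad w p c d) :
    HasGrad (fun q => v q + w q) p (a + c) (b + d) := by
  exact (of_hasFDerivAt (HasFDerivAt.fun_add hv hw)).congr_grad (by simp) (by simp)

theorem sub (hv : HasGrad v p a b) (hw : HasGrad w p c d) :
    HasGrad (fun q => v q - w q) p (a - c) (b - d) := by
  exact (of_hasFDerivAt (HasFDerivAt.fun_sub hv hw)).congr_grad (by simp) (by simp)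

theorem neg (hv : HasGrad v p a b) : HasGrad (fun q => -v q) p (-a) (-b) := by
  exact (of_hasFDerivAt (HasFDerivAt.fun_neg hv)).congr_grad (by simp) (by simp)

theorem mul (hv : HasGrad v p a b) (hw : HasGrad w p c d) :
    HasGrad (fun q => v q * w q) p (a * w p + v p * c) (b * w p + v p * d) := by
  exact (of_hasFDerivAt (HasFDerivAt.fun_mul hv hw)).congr_grad (by simp; ring) (by simp; ring)

theorem const_mul (k : ℝ) (hw : HasGrad w p c d) :
    HasGrad (fun q => k * w q) p (k * c) (k * d) :=
  ((const k).mul hw).congr_grad (by ring) (by ring)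

theorem comp {h : ℝ → ℝ} {h' : ℝ} (hh : HasDerivAt h h' (w p)) (hw : HasGrad w p a b) :
    HasGrad (fun q => h (w q)) p (h' * a) (h' * b) := by
  exact (of_hasFDerivAt (hh.comp_hasFDerivAt p hw)).congr_grad (by simp) (by simp)

theorem congr_eventuallyEq (hw : HasGrad w p a b) (h : v =ᶠ[nhds p] w) : HasGrad v p a b :=
  HasFDerivAt.congr_of_eventuallyEq hw h

theorem continuousAt (hw : HasGrad w p a b) : ContinuousAt w p := HasFDerivAt.continuousAt hw

theorem fderiv_fst (hw : HasGrad w p a b) : fderiv ℝ w p (1, 0) = a := by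
  rw [HasFDerivAt.fderiv hw]; simp

theorem fderiv_snd (hw : HasGrad w p a b) : fderiv ℝ w p (0, 1) = b := by
  rw [HasFDerivAt.fderiv hw]; simp

theorem hasDerivAt_fst (hw : HasGrad w p a b) : HasDerivAt (fun x => w (x, p.2)) a p.1 := by
  have h1 : HasDerivAt (fun x : ℝ => (x, p.2)) ((1 : ℝ), (0 : ℝ)) p.1 :=
    (hasDerivAt_id p.1).prodMk (hasDerivAt_const p.1 p.2)
  have := HasFDerivAt.comp_hasDerivAt (f := fun x : ℝ => (x, p.2)) p.1 hw h1
  simpa [Function.comp_def] using this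

theorem hasDerivAt_snd (hw : HasGrad w p a b) : HasDerivAt (fun y => w (p.1, y)) b p.2 := by
  have h1 : HasDerivAt (fun y : ℝ => (p.1, y)) ((0 : ℝ), (1 : ℝ)) p.2 :=
    (hasDerivAt_const p.2 p.1).prodMk (hasDerivAt_id p.2)
  have := HasFDerivAt.comp_hasDerivAt (f := fun y : ℝ => (p.1, y)) p.2 hw h1
  simpa [Function.comp_def] using this

theorem partialX_eq (hw : HasGrad w p a b) : partialX w p = a := hw.hasDerivAt_fst.deriv

theorem partialY_eq (hw : HasGrad w p a b) : partialY w p = b := hw.hasDerivAt_snd.deriv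

/-- The chain rule along a curve. -/
theorem comp_curve {α β : ℝ → ℝ} {α' β' t : ℝ} (hα : HasDerivAt α α' t) (hβ : HasDerivAt β β' t)
    (hw : HasGrad w (α t, β t) a b) :
    HasDerivAt (fun s => w (α s, β s)) (a * α' + b * β') t := by
  have := HasFDerivAt.comp_hasDerivAt (f := fun s : ℝ => (α s, β s)) t hw (hα.prodMk hβ)
  simpa [Function.comp_def] using this

theorem of_sq_bound {C : ℝ} (hp : p.2 = 0) (h : ∀ᶠ q in nhds p, |w q| ≤ C * q.2 ^ 2) :
    HasGrad w p 0 0 := by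
  have hp0 : w p = 0 := by
    have := h.self_of_nhds
    rw [hp] at this
    simpa using this
  have hO : (fun q : ℝ × ℝ => w q - w p - (0 : ℝ × ℝ →L[ℝ] ℝ) (q - p)) =o[nhds p]
      fun q => q - p := by
    have h1 : (fun q : ℝ × ℝ => w q - w p - (0 : ℝ × ℝ →L[ℝ] ℝ) (q - p)) =O[nhds p]
        fun q => ‖q - p‖ ^ 2 := by
      refine Asymptotics.IsBigO.of_bound |C| ?_
      filter_upwards [h] with q hq
      have h2 : |q.2| ≤ ‖q - p‖ := by
        have := norm_snd_le (q - p)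
        simpa [hp] using this
      have h3 : q.2 ^ 2 ≤ ‖q - p‖ ^ 2 := by
        rw [← sq_abs]; gcongr
      simp only [hp0, sub_zero, zero_apply, Real.norm_eq_abs, abs_pow, abs_norm]
      calc |w q| ≤ C * q.2 ^ 2 := hq
        _ ≤ |C| * q.2 ^ 2 := by gcongr; exact le_abs_self C
        _ ≤ _ := by gcongr
    refine h1.trans_isLittleO ?_
    have h4 : (fun q : ℝ × ℝ => ‖q - p‖ ^ 2) =o[nhds p] fun q => ‖q - p‖ := by
      have h5 : Filter.Tendsto (fun q : ℝ × ℝ => ‖q - p‖) (nhds p) (nhds 0) := by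
        have : Continuous fun q : ℝ × ℝ => ‖q - p‖ := by fun_prop
        simpa using this.tendsto p
      exact (Asymptotics.isLittleO_pow_id one_lt_two).comp_tendsto h5
    exact h4.of_norm_right
  have : HasFDerivAt w (0 : ℝ × ℝ →L[ℝ] ℝ) p := .of_isLittleO hO
  simpa [HasGrad] using this

end HasGrad

/-- A continuous even weight vanishing for `|s| ≤ t` and equal to `1` for `|s| ≥ 2 t`. -/
noncomputable def truncWeight (t s : ℝ) : ℝ := min 1 (max 0 (|s| / t - 1))

/-- The primitive of `truncWeight t`: a truncation of the identity near the origin. -/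
noncomputable def trunc (t z : ℝ) : ℝ := ∫ s in (0 : ℝ)..z, truncWeight t s

/-- The primitive of `trunc t`. -/
noncomputable def truncPrim (t z : ℝ) : ℝ := ∫ s in (0 : ℝ)..z, trunc t s

section Truncation

variable {t z : ℝ}

theorem continuous_truncWeight (t : ℝ) : Continuous (truncWeight t) := by
  unfold truncWeight; fun_prop

theorem truncWeight_nonneg (t s : ℝ) : 0 ≤ truncWeight t s := by simp [truncWeight]

theorem truncWeight_le_one (t s : ℝ) : truncWeight t s ≤ 1 := by simp [truncWeight]

theorem truncWeight_eq_zero (ht : 0 < t) {s : ℝ} (hs : |s| ≤ t) : truncWeight t s = 0 := by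
  have : |s| / t - 1 ≤ 0 := by rw [sub_nonpos, div_le_one ht]; exact hs
  simp [truncWeight, max_eq_left this]

theorem truncWeight_eq_one (ht : 0 < t) {s : ℝ} (hs : 2 * t ≤ |s|) : truncWeight t s = 1 := by
  have : 1 ≤ |s| / t - 1 := by rw [le_sub_iff_add_le, le_div_iff₀ ht]; linarith
  simp [truncWeight, this]

theorem hasDerivAt_trunc (t z : ℝ) : HasDerivAt (trunc t) (truncWeight t z) z :=
  intervalIntegral.integral_hasDerivAt_right
    ((continuous_truncWeight t).intervalIntegrable _ _)
    ((continuous_truncWeight t).stronglyMeasurableAtFilter _ _)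
    (continuous_truncWeight t).continuousAt

theorem continuous_trunc (t : ℝ) : Continuous (trunc t) :=
  continuous_iff_continuousAt.2 fun z => (hasDerivAt_trunc t z).continuousAt

theorem hasDerivAt_truncPrim (t z : ℝ) : HasDerivAt (truncPrim t) (trunc t z) z :=
  intervalIntegral.integral_hasDerivAt_right
    ((continuous_trunc t).intervalIntegrable _ _)
    ((continuous_trunc t).stronglyMeasurableAtFilter _ _)
    (continuous_trunc t).continuousAt

theorem continuous_truncPrim (t : ℝ) : Continuous (truncPrim t) :=
  continuous_iff_continuousAt.2 fun z => (hasDerivAt_truncPrim t z).continuousAt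

theorem abs_le_of_mem_uIcc_zero {s : ℝ} (hs : s ∈ uIcc 0 z) : |s| ≤ |z| := by
  simpa using abs_sub_left_of_mem_uIcc hs

theorem trunc_eq_zero (ht : 0 < t) (hz : |z| ≤ t) : trunc t z = 0 := by
  unfold trunc
  rw [intervalIntegral.integral_congr (g := fun _ => (0 : ℝ))]
  · simp
  · exact fun s hs => truncWeight_eq_zero ht ((abs_le_of_mem_uIcc_zero hs).trans hz)

theorem truncPrim_eq_zero (ht : 0 < t) (hz : |z| ≤ t) : truncPrim t z = 0 := by
  unfold truncPrim
  rw [intervalIntegral.integral_congr (g := fun _ => (0 : ℝ))]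
  · simp
  · exact fun s hs => trunc_eq_zero ht ((abs_le_of_mem_uIcc_zero hs).trans hz)

theorem monotone_trunc (t : ℝ) : Monotone (trunc t) :=
  monotone_of_deriv_nonneg (fun z => (hasDerivAt_trunc t z).differentiableAt)
    fun z => by rw [(hasDerivAt_trunc t z).deriv]; exact truncWeight_nonneg t z

theorem trunc_zero (t : ℝ) : trunc t 0 = 0 := by simp [trunc]

theorem trunc_sq_le (t z : ℝ) : trunc t z ^ 2 / 2 ≤ truncPrim t z := by
  set F : ℝ → ℝ := fun z => truncPrim t z - trunc t z ^ 2 / 2 with hF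
  have hd : ∀ z, HasDerivAt F (trunc t z * (1 - truncWeight t z)) z := fun z => by
    refine ((hasDerivAt_truncPrim t z).sub
      (((hasDerivAt_trunc t z).pow 2).div_const 2)).congr_deriv ?_
    push_cast; ring
  have hc : Continuous F := continuous_iff_continuousAt.2 fun z => (hd z).continuousAt
  have h0 : F 0 = 0 := by simp [hF, truncPrim, trunc_zero]
  have hw : ∀ z, 0 ≤ 1 - truncWeight t z := fun z => sub_nonneg.2 (truncWeight_le_one t z)
  suffices 0 ≤ F z by simpa [hF] using this
  rcases le_total 0 z with hz | hz
  · rw [← h0]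
    refine monotoneOn_of_deriv_nonneg (convex_Ici 0) hc.continuousOn
      (fun x _ => (hd x).differentiableAt.differentiableWithinAt) (fun x hx => ?_)
      self_mem_Ici hz hz
    rw [interior_Ici, mem_Ioi] at hx
    rw [(hd x).deriv]
    exact mul_nonneg (by simpa [trunc_zero] using monotone_trunc t hx.le) (hw x)
  · rw [← h0]
    refine antitoneOn_of_deriv_nonpos (convex_Iic 0) hc.continuousOn
      (fun x _ => (hd x).differentiableAt.differentiableWithinAt) (fun x hx => ?_)
      hz self_mem_Iic hz
    rw [interior_Iic, mem_Iio] at hx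
    rw [(hd x).deriv]
    exact mul_nonpos_of_nonpos_of_nonneg (by simpa [trunc_zero] using monotone_trunc t hx.le) (hw x)

theorem tendsto_truncWeight {t : ℕ → ℝ} (ht : ∀ n, 0 < t n)
    (ht0 : Filter.Tendsto t Filter.atTop (nhds 0)) {s : ℝ} (hs : s ≠ 0) :
    Filter.Tendsto (fun n => truncWeight (t n) s) Filter.atTop (nhds 1) := by
  refine tendsto_const_nhds.congr' ?_
  filter_upwards [ht0.eventually (gt_mem_nhds (half_pos (abs_pos.2 hs)))] with n hn
  exact (truncWeight_eq_one (ht n) (by linarith)).symm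

theorem tendsto_trunc {t : ℕ → ℝ} (ht : ∀ n, 0 < t n)
    (ht0 : Filter.Tendsto t Filter.atTop (nhds 0)) (z : ℝ) :
    Filter.Tendsto (fun n => trunc (t n) z) Filter.atTop (nhds z) := by
  have h := intervalIntegral.tendsto_integral_filter_of_dominated_convergence
    (F := fun n s => truncWeight (t n) s) (f := fun _ => (1 : ℝ)) (a := 0) (b := z)
    (μ := volume) (l := Filter.atTop) (fun _ => (1 : ℝ))
    (Filter.Eventually.of_forall fun n => (continuous_truncWeight (t n)).aestronglyMeasurable)
    (Filter.Eventually.of_forall fun n => Filter.Eventually.of_forall fun s _ => by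
      rw [Real.norm_eq_abs, abs_of_nonneg (truncWeight_nonneg _ _)]
      exact truncWeight_le_one _ _)
    intervalIntegrable_const
    (by
      filter_upwards [compl_mem_ae_iff.2 (measure_singleton (0 : ℝ))] with s hs _
      exact tendsto_truncWeight ht ht0 hs)
  simpa [trunc] using h

end Truncation

/-- The open unit disk. -/
def unitDisk : Set (ℝ × ℝ) := {p : ℝ × ℝ | p.1 ^ 2 + p.2 ^ 2 < 1}

theorem isOpen_unitDisk : IsOpen unitDisk := isOpen_lt (by fun_prop) (by fun_prop)

theorem measurableSet_unitDisk : MeasurableSet unitDisk := isOpen_unitDisk.measurableSet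

theorem abs_lt_one_of_mem_unitDisk {p : ℝ × ℝ} (hp : p ∈ unitDisk) : |p.1| < 1 ∧ |p.2| < 1 := by
  have hp' : p.1 ^ 2 + p.2 ^ 2 < 1 := hp
  constructor <;> rw [← sq_lt_one_iff_abs_lt_one] <;> nlinarith [sq_nonneg p.1, sq_nonneg p.2]

theorem unitDisk_subset_box : unitDisk ⊆ Icc (-1) 1 ×ˢ Icc (-1) 1 := fun p hp => by
  obtain ⟨h1, h2⟩ := abs_lt_one_of_mem_unitDisk hp
  exact ⟨⟨(abs_lt.1 h1).1.le, (abs_lt.1 h1).2.le⟩, (abs_lt.1 h2).1.le, (abs_lt.1 h2).2.le⟩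

theorem volume_unitDisk_le : volume unitDisk ≤ 4 := by
  refine (measure_mono unitDisk_subset_box).trans ?_
  rw [Measure.volume_eq_prod, Measure.prod_prod]
  simp only [Real.volume_Icc, sub_neg_eq_add]
  rw [← ENNReal.ofReal_mul (by norm_num)]
  norm_num

/-- The divergence theorem for differentiable fields supported in the unit disk. -/
theorem setIntegral_divergence_eq_zero {P₁ P₂ : ℝ × ℝ → ℝ}
    (h₁ : Differentiable ℝ P₁) (h₂ : Differentiable ℝ P₂)
    (z₁ : ∀ p ∉ unitDisk, P₁ p = 0) (z₂ : ∀ p ∉ unitDisk, P₂ p = 0)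
    (zd : ∀ p ∉ unitDisk, fderiv ℝ P₁ p (1, 0) + fderiv ℝ P₂ p (0, 1) = 0)
    (hi : IntegrableOn (fun p => fderiv ℝ P₁ p (1, 0) + fderiv ℝ P₂ p (0, 1)) unitDisk) :
    ∫ p in unitDisk, (fderiv ℝ P₁ p (1, 0) + fderiv ℝ P₂ p (0, 1)) = 0 := by
  set g := fun p => fderiv ℝ P₁ p (1, 0) + fderiv ℝ P₂ p (0, 1) with hg
  have hig : Integrable g := hi.integrable_of_forall_notMem_eq_zero zd
  have hout : ∀ a b : ℝ, (a = 1 ∨ a = -1 ∨ b = 1 ∨ b = -1) → (a, b) ∉ unitDisk := by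
    rintro a b h hm
    obtain ⟨h1, h2⟩ := abs_lt_one_of_mem_unitDisk hm
    rcases h with h | h | h | h <;> simp_all
  have key := integral2_divergence_prod_of_hasFDerivAt_off_countable P₁ P₂ (fderiv ℝ P₁)
    (fderiv ℝ P₂) (-1) (-1) 1 1 ∅ countable_empty h₁.continuous.continuousOn
    h₂.continuous.continuousOn (fun x _ => (h₁ x).hasFDerivAt) (fun x _ => (h₂ x).hasFDerivAt)
    hig.integrableOn
  have hz : ∀ F : ℝ × ℝ → ℝ, (∀ p ∉ unitDisk, F p = 0) →
      (∀ x, F (x, 1) = 0) ∧ (∀ x, F (x, -1) = 0) ∧ (∀ y, F (1, y) = 0) ∧ ∀ y, F (-1, y) = 0 :=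
    fun F hF => ⟨fun x => hF _ (hout _ _ (by simp)), fun x => hF _ (hout _ _ (by simp)),
      fun x => hF _ (hout _ _ (by simp)), fun x => hF _ (hout _ _ (by simp))⟩
  simp only [(hz P₁ z₁).2.2.1, (hz P₁ z₁).2.2.2, (hz P₂ z₂).1, (hz P₂ z₂).2.1,
    intervalIntegral.integral_zero, sub_zero, add_zero] at key
  rw [setIntegral_eq_integral_of_forall_compl_eq_zero zd,
    ← setIntegral_eq_integral_of_forall_compl_eq_zero (s := Icc (-1) 1 ×ˢ Icc (-1) 1)
      (fun p hp => zd p fun h => hp (unitDisk_subset_box h)),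
    Measure.volume_eq_prod, setIntegral_prod _ hig.integrableOn]
  simp only [intervalIntegral.integral_of_le (show (-1 : ℝ) ≤ 1 by norm_num)] at key
  simpa only [integral_Icc_eq_integral_Ioc] using key

theorem energy_pointwise {ε C y m θ T wx wy n₁ n₂ d ρ : ℝ} (hε : 0 < ε) (hε1 : ε ≤ 1) (hC : 0 ≤ C)
    (hy : |y| ≤ 1) (hm0 : 0 ≤ m) (hm1 : m ≤ 1) (hT : θ ^ 2 / 2 ≤ T) (hn₁ : |n₁| ≤ ε * C)
    (hn₂ : |n₂| ≤ ε * C) (hd : |d| ≤ ρ) :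
    ε / 2 * m * (wx ^ 2 + wy ^ 2) + θ ^ 2 / 4 ≤
      d * ((y + 2) * θ) + ε * (y + 2) * m * (wx ^ 2 + wy ^ 2) + T
        + n₁ * ((y + 2) * m * wx) + n₂ * ((y + 2) * m * wy + θ)
        + (11 * C ^ 2 * ε + 18 * ρ ^ 2) := by
  obtain ⟨hy1, hy2⟩ := abs_le.1 hy
  have hρ : 0 ≤ ρ := (abs_nonneg d).trans hd
  have hy0 : 0 ≤ y + 2 := by linarith
  have hy3 : y + 2 ≤ 3 := by linarith
  have hgrad : ∀ n v : ℝ, |n| ≤ ε * C →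
      -(ε / 2 * m * v ^ 2 + 9 / 2 * C ^ 2 * ε) ≤ n * ((y + 2) * m * v) := fun n v hn => by
    have h1 : |n * ((y + 2) * m * v)| ≤ (ε * C) * (3 * m * |v|) := by
      rw [abs_mul, abs_mul, abs_mul, abs_of_nonneg hm0, abs_of_nonneg hy0]
      gcongr
    have h2 : (ε * C) * (3 * m * |v|) ≤ ε / 2 * m * v ^ 2 + 9 / 2 * C ^ 2 * ε := by
      rw [← sq_abs v]
      have h3 : 0 ≤ ε * m * (|v| - 3 * C) ^ 2 := by positivity
      have h4 : 0 ≤ ε * C ^ 2 * (1 - m) := mul_nonneg (by positivity) (by linarith)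
      nlinarith
    linarith [neg_abs_le (n * ((y + 2) * m * v))]
  have hθ1 : -(θ ^ 2 / 8 + 2 * C ^ 2 * ε) ≤ n₂ * θ := by
    have h1 : |n₂ * θ| ≤ (ε * C) * |θ| := by rw [abs_mul]; gcongr
    have h2 : (ε * C) * |θ| ≤ θ ^ 2 / 8 + 2 * C ^ 2 * ε := by
      rw [← sq_abs θ]
      have h3 : 0 ≤ (|θ| - 4 * (ε * C)) ^ 2 := sq_nonneg _
      have h4 : 0 ≤ C ^ 2 * ε * (1 - ε) := mul_nonneg (by positivity) (by linarith)
      nlinarith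
    linarith [neg_abs_le (n₂ * θ)]
  have hθ2 : -(θ ^ 2 / 8 + 18 * ρ ^ 2) ≤ d * ((y + 2) * θ) := by
    have h1 : |d * ((y + 2) * θ)| ≤ ρ * (3 * |θ|) := by
      rw [abs_mul, abs_mul, abs_of_nonneg hy0]
      gcongr
    have h2 : ρ * (3 * |θ|) ≤ θ ^ 2 / 8 + 18 * ρ ^ 2 := by
      rw [← sq_abs θ]
      nlinarith [sq_nonneg (|θ| - 12 * ρ)]
    linarith [neg_abs_le (d * ((y + 2) * θ))]
  have hmain : ε * m * (wx ^ 2 + wy ^ 2) ≤ ε * (y + 2) * m * (wx ^ 2 + wy ^ 2) := by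
    have : 0 ≤ ε * m * (wx ^ 2 + wy ^ 2) := by positivity
    nlinarith
  have h1 := hgrad n₁ wx hn₁
  have h2 := hgrad n₂ wy hn₂
  nlinarith

theorem isBounded_of_subset_unitDisk {K : Set (ℝ × ℝ)} (hK : K ⊆ unitDisk) :
    Bornology.IsBounded K :=
  ((isCompact_Icc.prod isCompact_Icc).isBounded).subset (hK.trans unitDisk_subset_box)

theorem exists_bound_on_unitDisk {ρ : ℝ × ℝ → ℝ} (hρ : Continuous ρ) :
    ∃ B, ∀ p ∈ unitDisk, |ρ p| ≤ B := by
  obtain ⟨B, hB⟩ := (isCompact_Icc.prod isCompact_Icc).exists_bound_of_continuousOn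
    (s := Icc (-1 : ℝ) 1 ×ˢ Icc (-1 : ℝ) 1) hρ.continuousOn
  exact ⟨B, fun p hp => hB p (unitDisk_subset_box hp)⟩

theorem integrableOn_unitDisk_of_continuous {ρ : ℝ × ℝ → ℝ} (hρ : Continuous ρ) :
    IntegrableOn ρ unitDisk :=
  (hρ.continuousOn.integrableOn_compact
    (isCompact_Icc.prod isCompact_Icc)).mono_set unitDisk_subset_box

section Energy

variable {ε C : ℝ} {w wx wy X₁ X₂ a b ρ : ℝ × ℝ → ℝ}

/-- The weighted energy estimate for a truncation of a function vanishing on the unit circle. -/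
theorem truncated_energy_le (hε : 0 < ε) (hε1 : ε ≤ 1) (hC : 0 ≤ C)
    (hw : Continuous w) (hw0 : ∀ p ∉ unitDisk, w p = 0)
    (hgw : ∀ p ∈ unitDisk, HasGrad w p (wx p) (wy p))
    (hX₁ : ∀ p ∈ unitDisk, ∃ a', HasGrad X₁ p (a p) a')
    (hX₂ : ∀ p ∈ unitDisk, ∃ b', HasGrad X₂ p b' (b p))
    (h₁ : ∀ p ∈ unitDisk, |X₁ p - ε * wx p| ≤ ε * C)
    (h₂ : ∀ p ∈ unitDisk, |X₂ p - ε * wy p| ≤ ε * C)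
    (hρ : ∀ p ∈ unitDisk, |a p + b p + wy p| ≤ ρ p) (hρc : Continuous ρ)
    {t : ℝ} (ht : 0 < t) :
    ∫⁻ p in unitDisk, ENNReal.ofReal (ε / 2 * truncWeight t (w p) * (wx p ^ 2 + wy p ^ 2)
        + trunc t (w p) ^ 2 / 4)
      ≤ ENNReal.ofReal (∫ p in unitDisk, (11 * C ^ 2 * ε + 18 * ρ p ^ 2)) := by
  set P₁ : ℝ × ℝ → ℝ := fun p => X₁ p * ((p.2 + 2) * trunc t (w p)) with hP₁
  set P₂ : ℝ × ℝ → ℝ := fun p => X₂ p * ((p.2 + 2) * trunc t (w p))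
    + (p.2 + (2 - ε)) * truncPrim t (w p) with hP₂
  set K : Set (ℝ × ℝ) := {p | t ≤ |w p|} with hK
  have hKD : K ⊆ unitDisk := fun p hp => by
    by_contra h
    have : t ≤ |w p| := hp
    rw [hw0 p h, abs_zero] at this
    linarith
  have hKc : IsCompact K :=
    Metric.isCompact_of_isClosed_isBounded (isClosed_le continuous_const hw.abs)
      (isBounded_of_subset_unitDisk hKD)
  have hoff : ∀ p ∉ K, ∀ᶠ q in nhds p, P₁ q = 0 ∧ P₂ q = 0 := fun p hp => by
    have hlt : |w p| < t := not_le.1 hp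
    filter_upwards [hw.abs.continuousAt.eventually (gt_mem_nhds hlt)] with q hq
    have hq' : |w q| ≤ t := le_of_lt hq
    simp [hP₁, hP₂, trunc_eq_zero ht hq', truncPrim_eq_zero ht hq']
  have hoff₁ : ∀ p ∉ K, HasGrad P₁ p 0 0 := fun p hp =>
    (HasGrad.const 0).congr_eventuallyEq ((hoff p hp).mono fun q hq => hq.1)
  have hoff₂ : ∀ p ∉ K, HasGrad P₂ p 0 0 := fun p hp =>
    (HasGrad.const 0).congr_eventuallyEq ((hoff p hp).mono fun q hq => hq.2)
  have hθ : ∀ p ∈ unitDisk, HasGrad (fun q => (q.2 + 2) * trunc t (w q)) p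
      ((p.2 + 2) * truncWeight t (w p) * wx p)
      ((p.2 + 2) * truncWeight t (w p) * wy p + trunc t (w p)) := fun p hp =>
    ((HasGrad.snd.add (HasGrad.const 2)).mul
      ((hgw p hp).comp (hasDerivAt_trunc t (w p)))).congr_grad (by ring) (by ring)
  have hin₁ : ∀ p ∈ unitDisk, ∃ c, HasGrad P₁ p (a p * ((p.2 + 2) * trunc t (w p))
      + X₁ p * ((p.2 + 2) * truncWeight t (w p) * wx p)) c := fun p hp => by
    obtain ⟨a', ha'⟩ := hX₁ p hp
    exact ⟨_, ha'.mul (hθ p hp)⟩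
  have hin₂ : ∀ p ∈ unitDisk, ∃ c, HasGrad P₂ p c (b p * ((p.2 + 2) * trunc t (w p))
      + X₂ p * ((p.2 + 2) * truncWeight t (w p) * wy p + trunc t (w p))
      + (truncPrim t (w p) + (p.2 + (2 - ε)) * (trunc t (w p) * wy p))) := fun p hp => by
    obtain ⟨b', hb'⟩ := hX₂ p hp
    exact ⟨_, ((hb'.mul (hθ p hp)).add ((HasGrad.snd.add (HasGrad.const (2 - ε))).mul
      ((hgw p hp).comp (hasDerivAt_truncPrim t (w p))))).congr_grad rfl (by ring)⟩
  have hd₁ : Differentiable ℝ P₁ := fun p => by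
    by_cases hp : p ∈ unitDisk
    · exact (hin₁ p hp).choose_spec.differentiableAt
    · exact (hoff₁ p fun h => hp (hKD h)).differentiableAt
  have hd₂ : Differentiable ℝ P₂ := fun p => by
    by_cases hp : p ∈ unitDisk
    · exact (hin₂ p hp).choose_spec.differentiableAt
    · exact (hoff₂ p fun h => hp (hKD h)).differentiableAt
  set g : ℝ × ℝ → ℝ := fun p => fderiv ℝ P₁ p (1, 0) + fderiv ℝ P₂ p (0, 1) with hg
  have hgoff : ∀ p ∉ K, g p = 0 := fun p hp => by
    simp only [hg]
    rw [(hoff₁ p hp).fderiv_fst, (hoff₂ p hp).fderiv_snd, add_zero]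
  have hgin : ∀ p ∈ unitDisk, g p = (a p + b p + wy p) * ((p.2 + 2) * trunc t (w p))
      + ε * (p.2 + 2) * truncWeight t (w p) * (wx p ^ 2 + wy p ^ 2) + truncPrim t (w p)
      + (X₁ p - ε * wx p) * ((p.2 + 2) * truncWeight t (w p) * wx p)
      + (X₂ p - ε * wy p) * ((p.2 + 2) * truncWeight t (w p) * wy p + trunc t (w p)) :=
    fun p hp => by
      simp only [hg]
      rw [(hin₁ p hp).choose_spec.fderiv_fst, (hin₂ p hp).choose_spec.fderiv_snd]
      ring
  have hgi : IntegrableOn g unitDisk := by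
    have hXc : ∀ {X : ℝ × ℝ → ℝ}, (∀ p ∈ unitDisk, ContinuousAt X p) →
        ∃ B, 0 ≤ B ∧ ∀ p ∈ K, |X p| ≤ B := fun hX => by
      obtain ⟨B, hB⟩ := hKc.exists_bound_of_continuousOn
        (fun p hp => (hX p (hKD hp)).continuousWithinAt)
      exact ⟨max B 0, le_max_right _ _, fun p hp => (hB p hp).trans (le_max_left _ _)⟩
    obtain ⟨B₁, hB₁0, hB₁⟩ := hXc fun p hp => (hX₁ p hp).choose_spec.continuousAt
    obtain ⟨B₂, hB₂0, hB₂⟩ := hXc fun p hp => (hX₂ p hp).choose_spec.continuousAt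
    obtain ⟨B₃, hB₃⟩ := exists_bound_on_unitDisk hρc
    obtain ⟨B₄, hB₄⟩ := exists_bound_on_unitDisk ((continuous_trunc t).comp hw)
    obtain ⟨B₅, hB₅⟩ := exists_bound_on_unitDisk ((continuous_truncPrim t).comp hw)
    have hslope : ∀ {X v B : ℝ}, |X| ≤ B → |X - ε * v| ≤ ε * C → |v| ≤ (ε * C + B) / ε :=
      fun {X v B} hX hv => by
        rw [le_div_iff₀ hε]
        have h3 : |ε * v| ≤ |X - ε * v| + |X| := by
          have := abs_sub X (X - ε * v)
          rw [sub_sub_cancel] at this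
          linarith
        rw [abs_mul, abs_of_pos hε] at h3
        linarith
    set V₁ := (ε * C + B₁) / ε with hV₁def
    set V₂ := (ε * C + B₂) / ε with hV₂def
    have hV₁ : 0 ≤ V₁ := by rw [hV₁def]; positivity
    have hV₂ : 0 ≤ V₂ := by rw [hV₂def]; positivity
    refine Measure.integrableOn_of_bounded (M := B₃ * (3 * B₄) + ε * 3 * 1 * (V₁ ^ 2 + V₂ ^ 2) + B₅
      + (ε * C) * (3 * 1 * V₁) + (ε * C) * (3 * 1 * V₂ + B₄))
      (ne_top_of_le_ne_top (by simp) volume_unitDisk_le)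
      ((measurable_fderiv_apply_const ℝ P₁ _).add
        (measurable_fderiv_apply_const ℝ P₂ _)).aestronglyMeasurable ?_
    refine (ae_restrict_iff' measurableSet_unitDisk).2 (Filter.Eventually.of_forall fun p hp => ?_)
    have hρp := hρ p hp
    have e₃ := (hρp.trans (le_abs_self _)).trans (hB₃ p hp)
    have e₄ := hB₄ p hp
    have e₅ := hB₅ p hp
    simp only [Function.comp_apply] at e₄ e₅
    have n₃ : 0 ≤ B₃ := (abs_nonneg _).trans e₃
    have n₄ : 0 ≤ B₄ := (abs_nonneg _).trans e₄
    have n₅ : 0 ≤ B₅ := (abs_nonneg _).trans e₅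
    by_cases hpK : p ∈ K
    · have v₁ : |wx p| ≤ V₁ := hslope (hB₁ p hpK) (h₁ p hp)
      have v₂ : |wy p| ≤ V₂ := hslope (hB₂ p hpK) (h₂ p hp)
      have m0 := truncWeight_nonneg t (w p)
      have m1 := truncWeight_le_one t (w p)
      obtain ⟨y1, y2⟩ := abs_lt.1 (abs_lt_one_of_mem_unitDisk hp).2
      have y0 : 0 ≤ p.2 + 2 := by linarith
      have y3 : p.2 + 2 ≤ 3 := by linarith
      have s₁ : wx p ^ 2 ≤ V₁ ^ 2 := by rw [← sq_abs]; gcongr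
      have s₂ : wy p ^ 2 ≤ V₂ ^ 2 := by rw [← sq_abs]; gcongr
      rw [hgin p hp, Real.norm_eq_abs]
      refine (abs_add_le _ _).trans (add_le_add ((abs_add_le _ _).trans (add_le_add
        ((abs_add_le _ _).trans (add_le_add ((abs_add_le _ _).trans (add_le_add ?_ ?_)) e₅))
        ?_)) ?_)
      · rw [abs_mul, abs_mul, abs_of_nonneg y0]
        gcongr
      · rw [abs_of_nonneg (by positivity)]
        gcongr
      · rw [abs_mul, abs_mul, abs_mul, abs_of_nonneg y0, abs_of_nonneg m0]
        gcongr
        exact h₁ p hp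
      · rw [abs_mul]
        refine mul_le_mul (h₂ p hp) ((abs_add_le _ _).trans (add_le_add ?_ e₄)) (abs_nonneg _)
          (by positivity)
        rw [abs_mul, abs_mul, abs_of_nonneg y0, abs_of_nonneg m0]
        gcongr
    · rw [hgoff p hpK, norm_zero]
      positivity
  have hg0 : ∫ p in unitDisk, g p = 0 := by
    refine setIntegral_divergence_eq_zero hd₁ hd₂ (fun p hp => ?_) (fun p hp => ?_)
      (fun p hp => hgoff p fun h => hp (hKD h)) hgi
    · simp [hP₁, hw0 p hp, trunc_zero]
    · simp [hP₂, hw0 p hp, trunc_zero, truncPrim]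
  have hhi : IntegrableOn (fun p => 11 * C ^ 2 * ε + 18 * ρ p ^ 2) unitDisk :=
    integrableOn_unitDisk_of_continuous (by fun_prop)
  have hpt : ∀ p ∈ unitDisk, ε / 2 * truncWeight t (w p) * (wx p ^ 2 + wy p ^ 2)
      + trunc t (w p) ^ 2 / 4 ≤ g p + (11 * C ^ 2 * ε + 18 * ρ p ^ 2) := fun p hp => by
    rw [hgin p hp]
    exact energy_pointwise hε hε1 hC (abs_lt_one_of_mem_unitDisk hp).2.le
      (truncWeight_nonneg _ _) (truncWeight_le_one _ _) (trunc_sq_le _ _) (h₁ p hp) (h₂ p hp)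
      (hρ p hp)
  calc _ ≤ ∫⁻ p in unitDisk, ENNReal.ofReal (g p + (11 * C ^ 2 * ε + 18 * ρ p ^ 2)) :=
        setLIntegral_mono' measurableSet_unitDisk fun p hp => ENNReal.ofReal_le_ofReal (hpt p hp)
    _ = ENNReal.ofReal (∫ p in unitDisk, (g p + (11 * C ^ 2 * ε + 18 * ρ p ^ 2))) := by
        refine (ofReal_integral_eq_lintegral_ofReal (hgi.add hhi) ?_).symm
        refine (ae_restrict_iff' measurableSet_unitDisk).2
          (Filter.Eventually.of_forall fun p hp => ?_)
        refine le_trans ?_ (hpt p hp)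
        have := truncWeight_nonneg t (w p)
        positivity
    _ = _ := by rw [integral_add hgi hhi, hg0, zero_add]

end Energy

/-- The gradient of a function vanishes almost everywhere on its zero set. -/
theorem ae_fderiv_eq_zero_of_eq_zero {w : ℝ × ℝ → ℝ} {U : Set (ℝ × ℝ)} (hU : MeasurableSet U)
    (hw : Measurable w) (hd : ∀ p ∈ U, DifferentiableAt ℝ w p) :
    ∀ᵐ p ∂(volume.restrict U), w p = 0 → fderiv ℝ w p = 0 := by
  set s : Set (ℝ × ℝ) := U ∩ w ⁻¹' {0} with hs
  have hsm : MeasurableSet s := hU.inter (hw (measurableSet_singleton 0))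
  have h := ApproximatesLinearOn.norm_fderiv_sub_le (μ := (volume : Measure (ℝ × ℝ)))
    (f := fun p => (w p, (0 : ℝ))) (A := 0) (δ := 0) (s := s)
    (by
      intro p hp q hq
      simp [show w p = 0 from hp.2, show w q = 0 from hq.2])
    hsm (fun p => (fderiv ℝ w p).prod 0)
    (fun p hp => ((hd p hp.1).hasFDerivAt.prodMk (hasFDerivAt_const 0 p)).hasFDerivWithinAt)
  rw [ae_restrict_iff' hsm] at h
  rw [ae_restrict_iff' hU]
  filter_upwards [h] with p hp hpU hp0
  have h1 := hp ⟨hpU, hp0⟩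
  rw [sub_zero, nonpos_iff_eq_zero, nnnorm_eq_zero] at h1
  ext <;> simpa using congrArg Prod.fst (DFunLike.congr_fun h1 _)

section Energy

variable {ε C : ℝ} {w wx wy X₁ X₂ a b ρ : ℝ × ℝ → ℝ}

/-- The weighted energy estimate for a function vanishing on the unit circle. -/
theorem energy_le (hε : 0 < ε) (hε1 : ε ≤ 1) (hC : 0 ≤ C)
    (hw : Continuous w) (hw0 : ∀ p ∉ unitDisk, w p = 0)
    (hgw : ∀ p ∈ unitDisk, HasGrad w p (wx p) (wy p))
    (hX₁ : ∀ p ∈ unitDisk, ∃ a', HasGrad X₁ p (a p) a')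
    (hX₂ : ∀ p ∈ unitDisk, ∃ b', HasGrad X₂ p b' (b p))
    (h₁ : ∀ p ∈ unitDisk, |X₁ p - ε * wx p| ≤ ε * C)
    (h₂ : ∀ p ∈ unitDisk, |X₂ p - ε * wy p| ≤ ε * C)
    (hρ : ∀ p ∈ unitDisk, |a p + b p + wy p| ≤ ρ p) (hρc : Continuous ρ) :
    ∫⁻ p in unitDisk, ENNReal.ofReal (ε / 2 * (wx p ^ 2 + wy p ^ 2) + w p ^ 2 / 4)
      ≤ ENNReal.ofReal (∫ p in unitDisk, (11 * C ^ 2 * ε + 18 * ρ p ^ 2)) := by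
  set t : ℕ → ℝ := fun n => 1 / ((n : ℝ) + 1) with ht
  have htpos : ∀ n, 0 < t n := fun n => by simp only [ht]; positivity
  have ht0 : Filter.Tendsto t Filter.atTop (nhds 0) := tendsto_one_div_add_atTop_nhds_zero_nat
  set F : ℕ → ℝ × ℝ → ENNReal := fun n p => ENNReal.ofReal
    (ε / 2 * truncWeight (t n) (w p) * (wx p ^ 2 + wy p ^ 2) + trunc (t n) (w p) ^ 2 / 4) with hF
  have hmx : AEMeasurable wx (volume.restrict unitDisk) :=
    (measurable_fderiv_apply_const ℝ w (1, 0)).aemeasurable.congr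
      ((ae_restrict_iff' measurableSet_unitDisk).2
        (Filter.Eventually.of_forall fun p hp => (hgw p hp).fderiv_fst))
  have hmy : AEMeasurable wy (volume.restrict unitDisk) :=
    (measurable_fderiv_apply_const ℝ w (0, 1)).aemeasurable.congr
      ((ae_restrict_iff' measurableSet_unitDisk).2
        (Filter.Eventually.of_forall fun p hp => (hgw p hp).fderiv_snd))
  have hFm : ∀ n, AEMeasurable (F n) (volume.restrict unitDisk) := fun n => by
    have h1 : AEMeasurable (fun p => truncWeight (t n) (w p)) (volume.restrict unitDisk) :=
      ((continuous_truncWeight (t n)).comp hw).aemeasurable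
    have h2 : AEMeasurable (fun p => trunc (t n) (w p)) (volume.restrict unitDisk) :=
      ((continuous_trunc (t n)).comp hw).aemeasurable
    exact (((h1.const_mul _).mul ((hmx.pow_const 2).add (hmy.pow_const 2))).add
      ((h2.pow_const 2).div_const 4)).ennreal_ofReal
  have hlim : ∀ᵐ p ∂(volume.restrict unitDisk),
      ENNReal.ofReal (ε / 2 * (wx p ^ 2 + wy p ^ 2) + w p ^ 2 / 4)
        = Filter.liminf (fun n => F n p) Filter.atTop := by
    filter_upwards [ae_fderiv_eq_zero_of_eq_zero measurableSet_unitDisk hw.measurable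
      fun p hp => (hgw p hp).differentiableAt, ae_restrict_mem measurableSet_unitDisk] with p hp hpD
    refine (Filter.Tendsto.liminf_eq (ENNReal.tendsto_ofReal ?_)).symm
    refine Filter.Tendsto.add ?_ (((tendsto_trunc htpos ht0 (w p)).pow 2).div_const 4)
    by_cases h : w p = 0
    · have h1 := (hgw p hpD).fderiv_fst
      have h2 := (hgw p hpD).fderiv_snd
      rw [hp h] at h1 h2
      simp [← h1, ← h2]
    · simpa using ((tendsto_truncWeight htpos ht0 h).const_mul (ε / 2)).mul_const
        (wx p ^ 2 + wy p ^ 2)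
  rw [lintegral_congr_ae hlim]
  refine (lintegral_liminf_le' hFm).trans ?_
  refine (Filter.liminf_le_liminf (Filter.Eventually.of_forall fun n =>
    truncated_energy_le hε hε1 hC hw hw0 hgw hX₁ hX₂ h₁ h₂ hρ hρc (htpos n))).trans ?_
  simp

end Energy

theorem lintegral_exp_neg_mul_abs {k : ℝ} (hk : 0 < k) :
    ∫⁻ s : ℝ, ENNReal.ofReal (Real.exp (-k * |s|)) = ENNReal.ofReal (2 / k) := by
  have h : ∫ s : ℝ, Real.exp (-k * |s|) = 2 / k := by
    rw [integral_comp_abs (f := fun s => Real.exp (-k * s)),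
      integral_exp_mul_Ioi (by linarith) 0]
    simp [div_eq_mul_inv]
  have hi : Integrable fun s : ℝ => Real.exp (-k * |s|) := by
    by_contra hn
    rw [integral_undef hn] at h
    exact (div_pos two_pos hk).ne h
  rw [← ofReal_integral_eq_lintegral_ofReal hi
    (Filter.Eventually.of_forall fun s => (Real.exp_pos _).le), h]

/-- The profile of the residual of the boundary layer corrector. -/
noncomputable def layerProfile (ε : ℝ) (p : ℝ × ℝ) : ℝ :=
  |p.2| * Real.exp (-(|p.2| * (1 - p.1 ^ 2 - p.2 ^ 2)) / (4 * ε))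

theorem continuous_layerProfile (ε : ℝ) : Continuous (layerProfile ε) := by
  unfold layerProfile; fun_prop

theorem layerProfile_sq_le {ε b x y : ℝ} (hε : 0 < ε) (hb : 0 < b) (hbx : b ^ 2 = 1 - x ^ 2)
    (hy : |y| ≤ b) :
    layerProfile ε (x, y) ^ 2 ≤ b ^ 2 * (Real.exp (-(b ^ 2 / (4 * ε)) * |y|)
      + Real.exp (-(b ^ 2 / (4 * ε)) * |y - b|) + Real.exp (-(b ^ 2 / (4 * ε)) * |y + b|)) := by
  have hk : 0 < b ^ 2 / (4 * ε) := by positivity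
  have h1 : layerProfile ε (x, y) ^ 2
      = |y| ^ 2 * Real.exp (-(|y| * (b ^ 2 - |y| ^ 2)) / (2 * ε)) := by
    simp only [layerProfile, mul_pow, ← Real.exp_nat_mul]
    rw [hbx, sq_abs]
    congr 2
    field_simp
    push_cast
    ring
  have h0 := abs_nonneg y
  rw [h1]
  refine mul_le_mul (by gcongr) ?_ (Real.exp_pos _).le (by positivity)
  have hexp : ∀ d : ℝ, b / 2 * (b * d) ≤ |y| * (b ^ 2 - |y| ^ 2) →
      Real.exp (-(|y| * (b ^ 2 - |y| ^ 2)) / (2 * ε)) ≤ Real.exp (-(b ^ 2 / (4 * ε)) * d) := by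
    intro d hd
    rw [Real.exp_le_exp]
    have : -(b ^ 2 / (4 * ε)) * d = -(b / 2 * (b * d)) / (2 * ε) := by field_simp; ring
    rw [this]
    gcongr
  have e1 := Real.exp_pos (-(b ^ 2 / (4 * ε)) * |y|)
  have e2 := Real.exp_pos (-(b ^ 2 / (4 * ε)) * |y - b|)
  have e3 := Real.exp_pos (-(b ^ 2 / (4 * ε)) * |y + b|)
  rcases le_total |y| (b / 2) with h | h
  · have h2 : |y| ^ 2 ≤ (b / 2) ^ 2 := by gcongr
    have h3 : 0 ≤ |y| * (b ^ 2 / 2 - |y| ^ 2) := mul_nonneg h0 (by nlinarith)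
    have := hexp |y| (by nlinarith)
    linarith
  · have h3 : 0 ≤ (b - |y|) * (|y| * (b + |y|) - b ^ 2 / 2) :=
      mul_nonneg (sub_nonneg.2 hy) (by nlinarith)
    have hd := hexp (b - |y|) (by nlinarith)
    rcases le_total 0 y with hy0 | hy0
    · rw [abs_of_nonneg hy0] at hd hy ⊢
      rw [abs_of_nonpos (by linarith : y - b ≤ 0), neg_sub] at *
      rw [abs_of_nonneg hy0] at e1
      linarith
    · rw [abs_of_nonpos hy0] at hd hy ⊢
      rw [abs_of_nonneg (by linarith : 0 ≤ y + b)] at *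
      rw [abs_of_nonpos hy0] at e1
      rw [sub_neg_eq_add, add_comm b y] at hd
      linarith

theorem setIntegral_layerProfile_sq_le {ε : ℝ} (hε : 0 < ε) :
    ∫ p in unitDisk, layerProfile ε p ^ 2 ≤ 48 * ε := by
  have hc : Continuous fun p => layerProfile ε p ^ 2 := (continuous_layerProfile ε).pow 2
  suffices h : ∫⁻ p in unitDisk, ENNReal.ofReal (layerProfile ε p ^ 2)
      ≤ ENNReal.ofReal (48 * ε) by
    rw [integral_eq_lintegral_of_nonneg_ae (Filter.Eventually.of_forall fun p => sq_nonneg _)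
      hc.aestronglyMeasurable]
    exact ENNReal.toReal_le_of_le_ofReal (by positivity) h
  have hsec : ∀ x : ℝ, ∫⁻ y : ℝ, unitDisk.indicator
      (fun p => ENNReal.ofReal (layerProfile ε p ^ 2)) (x, y)
        ≤ (Icc (-1 : ℝ) 1).indicator (fun _ => ENNReal.ofReal (24 * ε)) x := by
    intro x
    by_cases hx : |x| < 1
    · have hx2 : 0 < 1 - x ^ 2 := by
        have := (sq_lt_one_iff_abs_lt_one x).2 hx
        linarith
      set b := √(1 - x ^ 2) with hb
      have hb0 : 0 < b := Real.sqrt_pos.2 hx2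
      have hbx : b ^ 2 = 1 - x ^ 2 := Real.sq_sqrt hx2.le
      set k := b ^ 2 / (4 * ε) with hk
      have hk0 : 0 < k := by positivity
      rw [indicator_of_mem (show x ∈ Icc (-1 : ℝ) 1 from
        ⟨(abs_lt.1 hx).1.le, (abs_lt.1 hx).2.le⟩)]
      calc _ ≤ ∫⁻ y : ℝ, ENNReal.ofReal (b ^ 2) * (ENNReal.ofReal (Real.exp (-k * |y|))
            + ENNReal.ofReal (Real.exp (-k * |y - b|))
            + ENNReal.ofReal (Real.exp (-k * |y + b|))) := by
            refine lintegral_mono fun y => ?_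
            by_cases hm : (x, y) ∈ unitDisk
            · rw [indicator_of_mem hm, ← ENNReal.ofReal_add (Real.exp_pos _).le (Real.exp_pos _).le,
                ← ENNReal.ofReal_add (by positivity) (Real.exp_pos _).le,
                ← ENNReal.ofReal_mul (by positivity)]
              refine ENNReal.ofReal_le_ofReal (layerProfile_sq_le hε hb0 hbx ?_)
              have hm' : x ^ 2 + y ^ 2 < 1 := hm
              exact abs_le_of_sq_le_sq (by linarith) hb0.le
            · rw [indicator_of_notMem hm]
              exact zero_le
        _ = ENNReal.ofReal (b ^ 2) * (ENNReal.ofReal (2 / k) + ENNReal.ofReal (2 / k)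
            + ENNReal.ofReal (2 / k)) := by
            rw [lintegral_const_mul _ (by fun_prop), lintegral_add_right _ (by fun_prop),
              lintegral_add_right _ (by fun_prop),
              lintegral_sub_right_eq_self (fun y => ENNReal.ofReal (Real.exp (-k * |y|))) b,
              lintegral_add_right_eq_self (fun y => ENNReal.ofReal (Real.exp (-k * |y|))) b,
              lintegral_exp_neg_mul_abs hk0]
        _ = ENNReal.ofReal (24 * ε) := by
            rw [← ENNReal.ofReal_add (by positivity) (by positivity),
              ← ENNReal.ofReal_add (by positivity) (by positivity),
              ← ENNReal.ofReal_mul (by positivity)]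
            congr 1
            rw [hk]
            field_simp
            ring
    · refine le_of_eq_of_le ?_ zero_le
      rw [← lintegral_zero (μ := (volume : Measure ℝ))]
      congr 1
      ext y
      exact indicator_of_notMem (fun h => hx (abs_lt_one_of_mem_unitDisk h).1) _
  rw [← lintegral_indicator measurableSet_unitDisk, Measure.volume_eq_prod,
    lintegral_prod _ ((hc.measurable.ennreal_ofReal.indicator measurableSet_unitDisk).aemeasurable)]
  refine (lintegral_mono hsec).trans ?_
  rw [lintegral_indicator_const measurableSet_Icc, Real.volume_Icc, ← ENNReal.ofReal_mul
    (by positivity)]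
  refine ENNReal.ofReal_le_ofReal ?_
  linarith

theorem hasFDerivAt_intervalIntegral_of_contDiff {K : (ℝ × ℝ) × ℝ → ℝ} (hK : ContDiff ℝ 1 K)
    (p : ℝ × ℝ) :
    HasFDerivAt (fun q => ∫ s in (0 : ℝ)..1, K (q, s))
      (∫ s in (0 : ℝ)..1,
        (fderiv ℝ K (p, s)).comp (ContinuousLinearMap.inl ℝ (ℝ × ℝ) ℝ)) p := by
  have hc : Continuous fun z : (ℝ × ℝ) × ℝ =>
      (fderiv ℝ K z).comp (ContinuousLinearMap.inl ℝ (ℝ × ℝ) ℝ) :=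
    (hK.continuous_fderiv one_ne_zero).clm_comp continuous_const
  obtain ⟨B, hB⟩ := ((isCompact_closedBall p 1).prod
    (isCompact_Icc (a := (0 : ℝ)) (b := 1))).exists_bound_of_continuousOn hc.continuousOn
  have hKc : ∀ q : ℝ × ℝ, Continuous fun s => K (q, s) := fun q =>
    hK.continuous.comp (by fun_prop)
  refine intervalIntegral.hasFDerivAt_integral_of_dominated_of_fderiv_le (bound := fun _ => B)
    (F' := fun q s => (fderiv ℝ K (q, s)).comp (ContinuousLinearMap.inl ℝ (ℝ × ℝ) ℝ))
    (Metric.closedBall_mem_nhds p one_pos)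
    (Filter.Eventually.of_forall fun q => (hKc q).aestronglyMeasurable)
    ((hKc p).intervalIntegrable _ _) ?_ ?_ intervalIntegrable_const ?_
  · exact (hc.comp (Continuous.prodMk_right p)).aestronglyMeasurable
  · refine Filter.Eventually.of_forall fun s hs q hq => hB (q, s) ⟨hq, ?_⟩
    rw [uIoc_of_le zero_le_one] at hs
    exact ⟨hs.1.le, hs.2⟩
  · refine Filter.Eventually.of_forall fun s _ q _ => ?_
    exact ((hK.differentiable one_ne_zero) (q, s)).hasFDerivAt.comp q
      (hasFDerivAt_prodMk_left q s)

/-- The primitive of `f` in the second variable, vanishing on the horizontal axis. -/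
noncomputable def primitive (f : ℝ × ℝ → ℝ) (p : ℝ × ℝ) : ℝ := ∫ s in (0 : ℝ)..p.2, f (p.1, s)

theorem exists_hasGrad_primitive {f : ℝ × ℝ → ℝ} (hf : ContDiff ℝ 1 f) :
    ∃ (g : ℝ × ℝ → ℝ), Continuous g ∧ ∀ p, HasGrad (primitive f) p (g p) (f p) := by
  set K : (ℝ × ℝ) × ℝ → ℝ := fun z => z.1.2 * f (z.1.1, z.1.2 * z.2) with hKdef
  have hK : ContDiff ℝ 1 K := by
    have : ContDiff ℝ 1 fun z : (ℝ × ℝ) × ℝ => f (z.1.1, z.1.2 * z.2) :=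
      hf.comp (by fun_prop)
    exact (by fun_prop : ContDiff ℝ 1 fun z : (ℝ × ℝ) × ℝ => z.1.2).mul this
  have heq : primitive f = fun q => ∫ s in (0 : ℝ)..1, K (q, s) := by
    funext q
    simp only [primitive, hKdef, intervalIntegral.integral_const_mul]
    rw [intervalIntegral.mul_integral_comp_mul_left (f := fun s => f (q.1, s))]
    simp
  have hd := hasFDerivAt_intervalIntegral_of_contDiff hK
  rw [← heq] at hd
  have hc : Continuous fun p : ℝ × ℝ => ∫ s in (0 : ℝ)..1,
      (fderiv ℝ K (p, s)).comp (ContinuousLinearMap.inl ℝ (ℝ × ℝ) ℝ) := by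
    refine intervalIntegral.continuous_parametric_intervalIntegral_of_continuous' ?_ _ _
    exact (hK.continuous_fderiv one_ne_zero).clm_comp continuous_const
  refine ⟨_, hc.clm_apply continuous_const, fun p => (HasGrad.of_hasFDerivAt (hd p)).congr_grad
    rfl ?_⟩
  have h1 := (HasGrad.of_hasFDerivAt (hd p)).hasDerivAt_snd
  have hfc : Continuous fun s => f (p.1, s) := hf.continuous.comp (by fun_prop)
  exact h1.unique (intervalIntegral.integral_hasDerivAt_right (hfc.intervalIntegrable _ _)
    (hfc.stronglyMeasurableAtFilter _ _) hfc.continuousAt)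

/-- A `C¹` function vanishing at `(±1, 0)` decays near these points along vertical chords of the
unit disk. -/
theorem exists_abs_le_mul_sqrt {f : ℝ × ℝ → ℝ} (hf : ContDiff ℝ 1 f) (h1 : f (1, 0) = 0)
    (h2 : f (-1, 0) = 0) :
    ∃ L, 0 ≤ L ∧ ∀ c s : ℝ, |c| ≤ 1 → |s| ≤ √(1 - c ^ 2) → |f (c, s)| ≤ L * √(1 - c ^ 2) := by
  obtain ⟨B, hB⟩ := (isCompact_closedBall (0 : ℝ × ℝ) 1).exists_bound_of_continuousOn
    (hf.continuous_fderiv one_ne_zero).continuousOn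
  have hB0 : 0 ≤ B := (norm_nonneg _).trans (hB 0 (by simp))
  refine ⟨B, hB0, fun c s hc hs => ?_⟩
  have hc2 : 0 ≤ 1 - c ^ 2 := by nlinarith [abs_nonneg c, sq_abs c]
  have hS0 := Real.sqrt_nonneg (1 - c ^ 2)
  have hS2 := Real.sq_sqrt hc2
  have hS1 : √(1 - c ^ 2) ≤ 1 := by nlinarith [sq_nonneg c]
  have key : ∀ e : ℝ, |e| ≤ 1 → f (e, 0) = 0 → |c - e| ≤ 1 - |c| →
      |f (c, s)| ≤ B * √(1 - c ^ 2) := fun e he hfe hce => by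
    have h := (convex_closedBall (0 : ℝ × ℝ) 1).norm_image_sub_le_of_norm_fderiv_le (f := f)
      (𝕜 := ℝ) (x := (e, 0)) (y := (c, s))
      (fun x _ => (hf.differentiable one_ne_zero) x) hB
      (by simpa [Prod.norm_def] using he) (by simpa [Prod.norm_def] using ⟨hc, hs.trans hS1⟩)
    rw [hfe, sub_zero, Real.norm_eq_abs] at h
    refine h.trans (mul_le_mul_of_nonneg_left ?_ hB0)
    simp only [Prod.norm_def, Prod.fst_sub, Prod.snd_sub, sub_zero, Real.norm_eq_abs]
    refine max_le (hce.trans ?_) hs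
    nlinarith [abs_nonneg c, sq_abs c]
  rcases le_total 0 c with h | h
  · exact key 1 (by simp) h1 (by rw [abs_of_nonneg h] at hc ⊢; rw [abs_of_nonpos] <;> linarith)
  · exact key (-1) (by simp) h2 (by rw [abs_of_nonpos h] at hc ⊢; rw [abs_of_nonneg] <;> linarith)

theorem hasDerivAt_sqrt_one_sub_sq {c : ℝ} (hc : |c| < 1) :
    HasDerivAt (fun t => √(1 - t ^ 2)) (-c / √(1 - c ^ 2)) c := by
  have hc2 : 1 - c ^ 2 ≠ 0 := by
    have := (sq_lt_one_iff_abs_lt_one c).2 hc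
    linarith
  have h := ((hasDerivAt_pow 2 c).const_sub 1).sqrt hc2
  convert h using 1
  push_cast
  field_simp

theorem exists_hasDerivAt_primitive_chord {f : ℝ × ℝ → ℝ} (hf : ContDiff ℝ 1 f)
    (h1 : f (1, 0) = 0) (h2 : f (-1, 0) = 0) :
    ∃ C, 0 ≤ C ∧ ∀ σ c : ℝ, |σ| ≤ 1 → |c| < 1 →
      ∃ d, |d| ≤ C ∧ HasDerivAt (fun t => primitive f (t, σ * √(1 - t ^ 2))) d c := by
  obtain ⟨g, hgc, hg⟩ := exists_hasGrad_primitive hf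
  obtain ⟨L, hL0, hL⟩ := exists_abs_le_mul_sqrt hf h1 h2
  obtain ⟨B, hB⟩ := (isCompact_closedBall (0 : ℝ × ℝ) 1).exists_bound_of_continuousOn
    hgc.continuousOn
  have hB0 : 0 ≤ B := (norm_nonneg _).trans (hB 0 (by simp))
  refine ⟨B + L, by positivity, fun σ c hσ hc => ?_⟩
  have hc2 : 0 < 1 - c ^ 2 := by
    have := (sq_lt_one_iff_abs_lt_one c).2 hc
    linarith
  have hS0 := Real.sqrt_pos.2 hc2
  have hS2 := Real.sq_sqrt hc2.le
  have hS1 : √(1 - c ^ 2) ≤ 1 := by nlinarith [sq_nonneg c]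
  have hσS : |σ * √(1 - c ^ 2)| ≤ √(1 - c ^ 2) := by
    rw [abs_mul, abs_of_pos hS0]
    exact mul_le_of_le_one_left hS0.le hσ
  refine ⟨_, ?_, HasGrad.comp_curve (hasDerivAt_id c)
    ((hasDerivAt_sqrt_one_sub_sq hc).const_mul σ) (hg _)⟩
  have hb1 := hB (c, σ * √(1 - c ^ 2))
    (mem_closedBall_zero_iff.2 (max_le hc.le (hσS.trans hS1)))
  have hb2 := hL c (σ * √(1 - c ^ 2)) hc.le hσS
  rw [Real.norm_eq_abs] at hb1
  refine (abs_add_le _ _).trans ?_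
  refine add_le_add (by simpa using hb1) ?_
  rw [abs_mul, abs_mul, abs_div, abs_neg, abs_of_pos hS0]
  calc _ ≤ L * √(1 - c ^ 2) * (1 * (1 / √(1 - c ^ 2))) := by gcongr
    _ = L := by field_simp

section LimitSolution

variable {f u0 : ℝ × ℝ → ℝ}

theorem limitSolution_eq (hf : Continuous f)
    (hu0 : ∀ p : ℝ × ℝ, u0 p = ∫ s in p.2..√(1 - p.1 ^ 2), f (p.1, s)) (p : ℝ × ℝ) :
    u0 p = primitive f (p.1, 1 * √(1 - p.1 ^ 2)) - primitive f p := by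
  have hfc : Continuous fun s => f (p.1, s) := hf.comp (by fun_prop)
  rw [hu0, primitive, primitive, one_mul,
    intervalIntegral.integral_interval_sub_left (hfc.intervalIntegrable _ _)
      (hfc.intervalIntegrable _ _)]

theorem continuous_limitSolution (hf : ContDiff ℝ 1 f)
    (hu0 : ∀ p : ℝ × ℝ, u0 p = ∫ s in p.2..√(1 - p.1 ^ 2), f (p.1, s)) : Continuous u0 := by
  obtain ⟨g, -, hg⟩ := exists_hasGrad_primitive hf
  have hc : Continuous (primitive f) := continuous_iff_continuousAt.2 fun p => (hg p).continuousAt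
  rw [funext (limitSolution_eq hf.continuous hu0)]
  exact (hc.comp (by fun_prop)).sub hc

theorem exists_hasGrad_limitSolution (hf : ContDiff ℝ 1 f) (h1 : f (1, 0) = 0)
    (h2 : f (-1, 0) = 0)
    (hu0 : ∀ p : ℝ × ℝ, u0 p = ∫ s in p.2..√(1 - p.1 ^ 2), f (p.1, s)) :
    ∃ C, 0 ≤ C ∧ ∀ p ∈ unitDisk, |f p| ≤ C ∧ ∃ a, |a| ≤ C ∧ HasGrad u0 p a (-f p) := by
  obtain ⟨g, hgc, hg⟩ := exists_hasGrad_primitive hf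
  obtain ⟨B, hB⟩ := (isCompact_closedBall (0 : ℝ × ℝ) 1).exists_bound_of_continuousOn
    (hgc.prodMk hf.continuous).continuousOn
  have hB0 : 0 ≤ B := (norm_nonneg _).trans (hB 0 (by simp))
  obtain ⟨C, hC0, hC⟩ := exists_hasDerivAt_primitive_chord hf h1 h2
  refine ⟨C + B, by positivity, fun p hp => ?_⟩
  have hpb := abs_lt_one_of_mem_unitDisk hp
  have hBp := hB p (by simpa [Prod.norm_def] using ⟨hpb.1.le, hpb.2.le⟩)
  simp only [Prod.norm_def, Real.norm_eq_abs] at hBp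
  obtain ⟨d, hd, hdd⟩ := hC 1 p.1 (by simp) hpb.1
  refine ⟨by linarith [(le_max_right _ _).trans hBp], d - g p, ?_, ?_⟩
  · exact (abs_sub _ _).trans (add_le_add hd ((le_max_left _ _).trans hBp))
  · rw [funext (limitSolution_eq hf.continuous hu0)]
    exact ((HasGrad.comp hdd HasGrad.fst).sub (hg p)).congr_grad (by ring) (by ring)

/-- The trace of the limit solution on the lower semicircle, as a function of the abscissa, is
`C¹` with bounded derivative inside and vanishes to first order in `1 - c²` at the endpoints. -/
theorem exists_bound_limitSolution_trace (hf : ContDiff ℝ 1 f) (h1 : f (1, 0) = 0)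
    (h2 : f (-1, 0) = 0)
    (hu0 : ∀ p : ℝ × ℝ, u0 p = ∫ s in p.2..√(1 - p.1 ^ 2), f (p.1, s)) :
    ∃ C, 0 ≤ C ∧ (∀ c, |c| ≤ 1 → |u0 (c, -√(1 - c ^ 2))| ≤ C * (1 - c ^ 2)) ∧
      ∀ c, |c| < 1 → ∃ d, |d| ≤ C ∧ HasDerivAt (fun t => u0 (t, -√(1 - t ^ 2))) d c := by
  obtain ⟨L, hL0, hL⟩ := exists_abs_le_mul_sqrt hf h1 h2
  obtain ⟨C, hC0, hC⟩ := exists_hasDerivAt_primitive_chord hf h1 h2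
  refine ⟨2 * C + 2 * L, by positivity, fun c hc => ?_, fun c hc => ?_⟩
  · have hc2 : 0 ≤ 1 - c ^ 2 := by nlinarith [abs_nonneg c, sq_abs c]
    have hS0 := Real.sqrt_nonneg (1 - c ^ 2)
    have hS2 := Real.sq_sqrt hc2
    rw [hu0]
    have hI := intervalIntegral.norm_integral_le_of_norm_le_const (a := -√(1 - c ^ 2))
      (b := √(1 - c ^ 2)) (f := fun s => f (c, s)) (C := L * √(1 - c ^ 2)) fun s hs => by
        rw [uIoc_of_le (by linarith)] at hs
        exact hL c s hc (abs_le.2 ⟨hs.1.le, hs.2⟩)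
    refine hI.trans ?_
    rw [sub_neg_eq_add, abs_of_nonneg (by positivity)]
    nlinarith [mul_nonneg hC0 hc2]
  · obtain ⟨d, hd, hdd⟩ := hC 1 c (by simp) hc
    obtain ⟨e, he, hee⟩ := hC (-1) c (by simp) hc
    refine ⟨d - e, (abs_sub _ _).trans (by linarith), ?_⟩
    rw [funext fun t => limitSolution_eq hf.continuous hu0 (t, -√(1 - t ^ 2))]
    simpa using hdd.fun_sub hee

end LimitSolution

/-- The distance to the origin. -/
noncomputable def radius (p : ℝ × ℝ) : ℝ := √(p.1 ^ 2 + p.2 ^ 2)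

theorem continuous_radius : Continuous radius := by unfold radius; fun_prop

theorem radius_nonneg (p : ℝ × ℝ) : 0 ≤ radius p := Real.sqrt_nonneg _

theorem radius_sq (p : ℝ × ℝ) : radius p ^ 2 = p.1 ^ 2 + p.2 ^ 2 := Real.sq_sqrt (by positivity)

theorem radius_pos {p : ℝ × ℝ} (hp : p.2 < 0) : 0 < radius p :=
  Real.sqrt_pos.2 (by nlinarith [sq_nonneg p.1])

theorem radius_le_one {p : ℝ × ℝ} (hp : p.1 ^ 2 + p.2 ^ 2 ≤ 1) : radius p ≤ 1 :=
  Real.sqrt_le_one.2 hp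

theorem hasGrad_radius {p : ℝ × ℝ} (hp : p.2 < 0) :
    HasGrad radius p (p.1 * (radius p)⁻¹) (p.2 * (radius p)⁻¹) := by
  have h0 : p.1 ^ 2 + p.2 ^ 2 ≠ 0 := by nlinarith [sq_nonneg p.1]
  have h1 : HasGrad (fun q => q.1 * q.1 + q.2 * q.2) p (2 * p.1) (2 * p.2) :=
    ((HasGrad.fst.mul HasGrad.fst).add (HasGrad.snd.mul HasGrad.snd)).congr_grad
      (by ring) (by ring)
  have h2 : HasGrad (fun q => q.1 ^ 2 + q.2 ^ 2) p (2 * p.1) (2 * p.2) := by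
    simpa only [sq] using h1
  refine (h2.comp (Real.hasDerivAt_sqrt h0)).congr_grad ?_ ?_ <;>
  · rw [← radius]; field_simp

theorem hasGrad_inv_radius {p : ℝ × ℝ} (hp : p.2 < 0) :
    HasGrad (fun q => (radius q)⁻¹) p (-(p.1 * (radius p)⁻¹ ^ 3)) (-(p.2 * (radius p)⁻¹ ^ 3)) := by
  have h0 := (radius_pos hp).ne'
  refine ((hasGrad_radius hp).comp (hasDerivAt_inv h0)).congr_grad ?_ ?_ <;>
  · field_simp

/-- The exponent of the boundary layer corrector is `layerPhase / ε`. -/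
noncomputable def layerPhase (p : ℝ × ℝ) : ℝ := p.2 * (radius p)⁻¹ - p.2

/-- The `x`-derivative of `layerPhase`. -/
noncomputable def layerPhaseX (p : ℝ × ℝ) : ℝ :=
  -(p.1 * p.2 * ((radius p)⁻¹ * (radius p)⁻¹ * (radius p)⁻¹))

/-- The `y`-derivative of `layerPhase`. -/
noncomputable def layerPhaseY (p : ℝ × ℝ) : ℝ :=
  (radius p)⁻¹ - p.2 * p.2 * ((radius p)⁻¹ * (radius p)⁻¹ * (radius p)⁻¹) - 1

theorem hasGrad_layerPhase {p : ℝ × ℝ} (hp : p.2 < 0) :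
    HasGrad layerPhase p (layerPhaseX p) (layerPhaseY p) := by
  refine ((HasGrad.snd.mul (hasGrad_inv_radius hp)).sub HasGrad.snd).congr_grad ?_ ?_ <;>
  · simp only [layerPhaseX, layerPhaseY]; ring

theorem exists_hasGrad_layerPhaseX_layerPhaseY {p : ℝ × ℝ} (hp : p.2 < 0) :
    ∃ a b c d, HasGrad layerPhaseX p a b ∧ HasGrad layerPhaseY p c d ∧
      a + d = -(p.2 * (radius p)⁻¹ ^ 3) := by
  have hi := hasGrad_inv_radius hp
  have hi3 := (hi.mul hi).mul hi
  refine ⟨_, _, _, _, ((HasGrad.fst.mul HasGrad.snd).mul hi3).neg,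
    (hi.sub ((HasGrad.snd.mul HasGrad.snd).mul hi3)).sub (HasGrad.const 1), ?_⟩
  have hr := (radius_pos hp).ne'
  have h2 : p.1 ^ 2 = radius p ^ 2 - p.2 ^ 2 := by rw [radius_sq]; ring
  field_simp
  ring_nf
  rw [h2]
  ring

theorem layerPhase_eikonal {p : ℝ × ℝ} (hp : p.2 < 0) :
    layerPhaseX p ^ 2 + layerPhaseY p ^ 2 + layerPhaseY p
      = p.1 ^ 2 * (radius p)⁻¹ ^ 4 * (1 - radius p) := by
  have hr := (radius_pos hp).ne'
  have h2 : p.1 ^ 2 = radius p ^ 2 - p.2 ^ 2 := by rw [radius_sq]; ring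
  simp only [layerPhaseX, layerPhaseY]
  field_simp
  ring_nf
  rw [h2]
  ring

theorem layerPhase_le {p : ℝ × ℝ} (hp : p.2 < 0) (h1 : p.1 ^ 2 + p.2 ^ 2 ≤ 1) :
    layerPhase p ≤ -(|p.2| * (1 - radius p)) := by
  have hr := radius_pos hp
  have hr1 := radius_le_one h1
  have : layerPhase p = -(|p.2| * (1 - radius p) * (radius p)⁻¹) := by
    rw [layerPhase, abs_of_neg hp]; field_simp
  rw [this, neg_le_neg_iff]
  exact le_mul_of_one_le_right (mul_nonneg (abs_nonneg _) (by linarith)) ((one_le_inv₀ hr).2 hr1)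

theorem abs_fst_mul_inv_radius_le {p : ℝ × ℝ} (hp : p.2 < 0) : |p.1 * (radius p)⁻¹| < 1 := by
  have hr := radius_pos hp
  rw [← sq_lt_one_iff_abs_lt_one, mul_pow, inv_pow, radius_sq, ← div_eq_mul_inv,
    div_lt_one (by nlinarith [sq_nonneg p.1])]
  nlinarith

theorem abs_snd_mul_inv_radius_le {p : ℝ × ℝ} (hp : p.2 < 0) : |p.2 * (radius p)⁻¹| ≤ 1 := by
  rw [← sq_le_one_iff_abs_le_one, mul_pow, inv_pow, radius_sq, ← div_eq_mul_inv,
    div_le_one (by nlinarith [sq_nonneg p.1])]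
  nlinarith [sq_nonneg p.1]

theorem abs_layerPhaseX_le {p : ℝ × ℝ} (hp : p.2 < 0) (hr : 1 / 4 ≤ radius p) :
    |layerPhaseX p| ≤ 4 := by
  have h1 := (abs_fst_mul_inv_radius_le hp).le
  have h2 := abs_snd_mul_inv_radius_le hp
  have h3 : |(radius p)⁻¹| ≤ 4 := by
    rw [abs_of_pos (inv_pos.2 (radius_pos hp))]
    exact inv_le_of_inv_le₀ (by norm_num) (by linarith)
  have : layerPhaseX p = -(p.1 * (radius p)⁻¹ * (p.2 * (radius p)⁻¹) * (radius p)⁻¹) := by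
    rw [layerPhaseX]; ring
  rw [this, abs_neg, abs_mul, abs_mul]
  calc _ ≤ 1 * 1 * (4 : ℝ) := by gcongr
    _ = 4 := by norm_num

theorem abs_layerPhaseY_le {p : ℝ × ℝ} (hp : p.2 < 0) (hr : 1 / 4 ≤ radius p) :
    |layerPhaseY p| ≤ 4 := by
  have h0 := inv_pos.2 (radius_pos hp)
  have h2 := abs_snd_mul_inv_radius_le hp
  have h3 : (radius p)⁻¹ ≤ 4 := inv_le_of_inv_le₀ (by norm_num) (by linarith)
  have h4 := (sq_le_one_iff_abs_le_one _).2 h2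
  have : layerPhaseY p = (radius p)⁻¹ * (1 - (p.2 * (radius p)⁻¹) ^ 2) - 1 := by
    rw [layerPhaseY]; ring
  rw [this, abs_le]
  constructor <;> nlinarith [sq_nonneg (p.2 * (radius p)⁻¹), mul_nonneg h0.le (sub_nonneg.2 h4),
    mul_nonneg h0.le (sq_nonneg (p.2 * (radius p)⁻¹))]

section Corrector

variable {G δ : ℝ → ℝ} {ε : ℝ} {p : ℝ × ℝ}

/-- The amplitude of the boundary layer corrector in the lower half disk. -/
noncomputable def layerAmplitude (G δ : ℝ → ℝ) (p : ℝ × ℝ) : ℝ :=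
  G (p.1 * (radius p)⁻¹) * δ (1 - radius p)

theorem layerAmplitude_eq_zero (hδ0 : ∀ η ∈ Icc (3 / 4 : ℝ) 1, δ η = 0)
    (hr : radius p < 1 / 4) : layerAmplitude G δ p = 0 := by
  rw [layerAmplitude, hδ0 _ ⟨by linarith, by linarith [radius_nonneg p]⟩, mul_zero]

theorem abs_trace_le {C : ℝ} (hC : 0 ≤ C) (hG : ∀ c, |c| ≤ 1 → |G c| ≤ C * (1 - c ^ 2))
    (hp : p.2 < 0) (hr : 1 / 4 ≤ radius p) : |G (p.1 * (radius p)⁻¹)| ≤ 16 * C * p.2 ^ 2 := by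
  have h0 := inv_pos.2 (radius_pos hp)
  have h3 : (radius p)⁻¹ ≤ 4 := inv_le_of_inv_le₀ (by norm_num) (by linarith)
  have h2 : 1 - (p.1 * (radius p)⁻¹) ^ 2 = p.2 ^ 2 * (radius p)⁻¹ ^ 2 := by
    have hr := (radius_pos hp).ne'
    field_simp
    rw [radius_sq]; ring
  refine (hG _ (abs_fst_mul_inv_radius_le hp).le).trans ?_
  rw [h2]
  calc C * (p.2 ^ 2 * (radius p)⁻¹ ^ 2) ≤ C * (p.2 ^ 2 * 4 ^ 2) := by gcongr
    _ = 16 * C * p.2 ^ 2 := by ring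

theorem abs_layerAmplitude_le {C : ℝ} (hC : 0 ≤ C)
    (hG : ∀ c, |c| ≤ 1 → |G c| ≤ C * (1 - c ^ 2))
    (hδr : ∀ η, δ η ∈ Icc (0 : ℝ) 1) (hδ0 : ∀ η ∈ Icc (3 / 4 : ℝ) 1, δ η = 0) (hp : p.2 < 0) :
    |layerAmplitude G δ p| ≤ 16 * C * p.2 ^ 2 := by
  rcases lt_or_ge (radius p) (1 / 4) with hr | hr
  · rw [layerAmplitude_eq_zero hδ0 hr, abs_zero]; positivity
  · rw [layerAmplitude, abs_mul, abs_of_nonneg (hδr _).1]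
    exact (mul_le_of_le_one_right (abs_nonneg _) (hδr _).2).trans (abs_trace_le hC hG hp hr)

theorem exists_hasGrad_layerAmplitude {C D : ℝ} (hC : 0 ≤ C) (hD : 0 ≤ D)
    (hG : ∀ c, |c| ≤ 1 → |G c| ≤ C * (1 - c ^ 2))
    (hG' : ∀ c, |c| < 1 → ∃ d, |d| ≤ C ∧ HasDerivAt G d c)
    (hδr : ∀ η, δ η ∈ Icc (0 : ℝ) 1) (hδ0 : ∀ η ∈ Icc (3 / 4 : ℝ) 1, δ η = 0)
    (hδ' : ∀ η ∈ Icc (0 : ℝ) 1, ∃ d, |d| ≤ D ∧ HasDerivAt δ d η)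
    (hp : p.2 < 0) (h1 : p ∈ unitDisk) :
    ∃ a b, HasGrad (layerAmplitude G δ) p a b ∧ |a| ≤ (64 * C + 16 * C * D) * |p.2| ∧
      |b| ≤ (64 * C + 16 * C * D) * |p.2| ∧ (radius p < 1 / 4 → a = 0 ∧ b = 0) := by
  rcases lt_or_ge (radius p) (1 / 4) with hr | hr
  · refine ⟨0, 0, (HasGrad.const 0).congr_eventuallyEq ?_, by simp; positivity,
      by simp; positivity, fun _ => ⟨rfl, rfl⟩⟩
    filter_upwards [continuous_radius.continuousAt.eventually_lt continuousAt_const hr] with q hq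
    exact layerAmplitude_eq_zero hδ0 hq
  · have hr0 := radius_pos hp
    have hr1 := radius_le_one (le_of_lt h1)
    have h0 := inv_pos.2 hr0
    have h3 : (radius p)⁻¹ ≤ 4 := inv_le_of_inv_le₀ (by norm_num) (by linarith)
    have hx := (abs_fst_mul_inv_radius_le hp).le
    have hy := abs_snd_mul_inv_radius_le hp
    have hy1 : |p.2| ≤ 1 := (abs_lt_one_of_mem_unitDisk h1).2.le
    have hx1 : |p.1| ≤ 1 := (abs_lt_one_of_mem_unitDisk h1).1.le
    obtain ⟨d, hd, hGd⟩ := hG' _ (abs_fst_mul_inv_radius_le hp)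
    obtain ⟨e, he, hδe⟩ := hδ' (1 - radius p) ⟨by linarith, by linarith⟩
    have hc : HasGrad (fun q => q.1 * (radius q)⁻¹) p (p.2 * p.2 * (radius p)⁻¹ ^ 3)
        (-(p.1 * p.2 * (radius p)⁻¹ ^ 3)) := by
      refine (HasGrad.fst.mul (hasGrad_inv_radius hp)).congr_grad ?_ (by ring)
      have := radius_sq p
      field_simp
      linarith
    have hη := ((HasGrad.const (p := p) 1).sub (hasGrad_radius hp)).comp
      (h := δ) (h' := e) hδe
    have hg := abs_trace_le hC hG hp hr
    have key : ∀ s t : ℝ, |s| ≤ 1 → |t| ≤ 1 →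
        |d * (s * p.2 * (radius p)⁻¹ ^ 3) * δ (1 - radius p)
          + G (p.1 * (radius p)⁻¹) * (e * t)| ≤ (64 * C + 16 * C * D) * |p.2| := by
      intro s t hs ht
      refine (abs_add_le _ _).trans ?_
      simp only [abs_mul, abs_pow, abs_of_pos h0, abs_of_nonneg (hδr (1 - radius p)).1]
      calc _ ≤ C * (1 * |p.2| * 4 ^ 3) * 1 + 16 * C * p.2 ^ 2 * (D * 1) := by
            gcongr
            · exact (hδr _).1
            · exact (hδr _).2
        _ ≤ C * (1 * |p.2| * 4 ^ 3) * 1 + 16 * C * |p.2| * (D * 1) := by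
            gcongr
            rw [← sq_abs]; nlinarith [abs_nonneg p.2]
        _ = _ := by ring
    refine ⟨_, _, ((hc.comp hGd).mul hη).congr_grad (c := d * (p.2 * p.2 * (radius p)⁻¹ ^ 3) *
        δ (1 - radius p) + G (p.1 * (radius p)⁻¹) * (e * -(p.1 * (radius p)⁻¹)))
      (d := d * (-p.1 * p.2 * (radius p)⁻¹ ^ 3) *
        δ (1 - radius p) + G (p.1 * (radius p)⁻¹) * (e * -(p.2 * (radius p)⁻¹)))
      (by ring) (by ring), key _ _ hy1 (by rwa [abs_neg]),
      key _ _ (by rwa [abs_neg]) (by rwa [abs_neg]), fun h => absurd hr h.not_ge⟩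

/-- The boundary layer corrector. -/
noncomputable def corrector (G δ : ℝ → ℝ) (ε : ℝ) (p : ℝ × ℝ) : ℝ :=
  if p.2 < 0 then -(layerAmplitude G δ p * Real.exp (ε⁻¹ * layerPhase p)) else 0

/-- The leading part of `-ε∇(corrector)`, where `Q` is a derivative of the phase. -/
noncomputable def layerFlux (G δ : ℝ → ℝ) (ε : ℝ) (Q : ℝ × ℝ → ℝ) (p : ℝ × ℝ) : ℝ :=
  if p.2 < 0 then layerAmplitude G δ p * Real.exp (ε⁻¹ * layerPhase p) * Q p else 0

theorem eventually_snd_neg (hp : p.2 < 0) : ∀ᶠ q : ℝ × ℝ in nhds p, q.2 < 0 :=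
  continuous_snd.continuousAt.eventually_lt continuousAt_const hp

theorem eventually_snd_pos (hp : 0 < p.2) : ∀ᶠ q : ℝ × ℝ in nhds p, 0 < q.2 :=
  ContinuousAt.eventually_lt continuousAt_const continuous_snd.continuousAt hp

theorem exp_layerPhase_le_one (hε : 0 < ε) (hp : p.2 < 0) (h1 : p.1 ^ 2 + p.2 ^ 2 ≤ 1) :
    Real.exp (ε⁻¹ * layerPhase p) ≤ 1 := by
  rw [Real.exp_le_one_iff]
  have := layerPhase_le hp h1
  have h2 : 0 ≤ |p.2| * (1 - radius p) :=
    mul_nonneg (abs_nonneg _) (by linarith [radius_le_one h1])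
  exact mul_nonpos_of_nonneg_of_nonpos (inv_pos.2 hε).le (by linarith)

/-- The exponential in the corrector absorbs a factor `|y| η / ε`. -/
theorem exp_layerPhase_mul_le (hε : 0 < ε) (hp : p.2 < 0) (h1 : p.1 ^ 2 + p.2 ^ 2 ≤ 1) :
    |p.2| * (Real.exp (ε⁻¹ * layerPhase p) * (1 + ε⁻¹ * (|p.2| * (1 - radius p))))
      ≤ 2 * layerProfile ε p := by
  set s := ε⁻¹ * (|p.2| * (1 - radius p)) with hs
  have hr1 := radius_le_one h1
  have hε' := inv_pos.2 hε
  have hs0 : 0 ≤ s := mul_nonneg hε'.le (mul_nonneg (abs_nonneg _) (by linarith))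
  have hE : Real.exp (ε⁻¹ * layerPhase p) ≤ Real.exp (-s) := by
    rw [Real.exp_le_exp, hs, ← mul_neg]
    exact mul_le_mul_of_nonneg_left (layerPhase_le hp h1) hε'.le
  have hs1 : 1 + s ≤ 2 * Real.exp (s / 2) := by linarith [Real.add_one_le_exp (s / 2)]
  have hη : Real.exp (-(s / 2)) ≤ Real.exp (-(|p.2| * (1 - p.1 ^ 2 - p.2 ^ 2)) / (4 * ε)) := by
    rw [Real.exp_le_exp, neg_div, neg_le_neg_iff, hs, div_le_iff₀ (by positivity)]
    have h3 : 1 - p.1 ^ 2 - p.2 ^ 2 ≤ 2 * (1 - radius p) := by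
      nlinarith [radius_sq p, sq_nonneg (1 - radius p)]
    calc |p.2| * (1 - p.1 ^ 2 - p.2 ^ 2) ≤ |p.2| * (2 * (1 - radius p)) := by gcongr
      _ = _ := by field_simp; ring
  calc _ ≤ |p.2| * (Real.exp (-s) * (2 * Real.exp (s / 2))) := by gcongr
    _ = 2 * (|p.2| * Real.exp (-(s / 2))) := by
      have : Real.exp (-(s / 2)) = Real.exp (-s) * Real.exp (s / 2) := by
        rw [← Real.exp_add]; congr 1; ring
      rw [this]; ring
    _ ≤ 2 * layerProfile ε p := by
      rw [layerProfile]; gcongr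

/-- Gradient bounds and residual bound for the corrector in the lower half disk. -/
theorem exists_hasGrad_corrector_of_neg {C : ℝ} {a b : ℝ} (hε : 0 < ε) (hC : 0 ≤ C)
    (hp : p.2 < 0) (h1 : p ∈ unitDisk) (hδ0 : ∀ η ∈ Icc (3 / 4 : ℝ) 1, δ η = 0)
    (hA : |layerAmplitude G δ p| ≤ C * p.2 ^ 2)
    (hgA : HasGrad (layerAmplitude G δ) p a b) (ha : |a| ≤ C * |p.2|) (hb : |b| ≤ C * |p.2|)
    (hz : radius p < 1 / 4 → a = 0 ∧ b = 0) :
    ∃ φx φy m₁ m₁' m₂' m₂, HasGrad (corrector G δ ε) p φx φy ∧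
      HasGrad (layerFlux G δ ε layerPhaseX) p m₁ m₁' ∧
      HasGrad (layerFlux G δ ε layerPhaseY) p m₂' m₂ ∧
      |ε * φx + layerFlux G δ ε layerPhaseX p| ≤ ε * C ∧
      |ε * φy + layerFlux G δ ε layerPhaseY p| ≤ ε * C ∧
      |m₁ + m₂ - φy| ≤ 146 * C * layerProfile ε p := by
  obtain ⟨q₁, q₁', q₂', q₂, hq1, hq2, hq⟩ := exists_hasGrad_layerPhaseX_layerPhaseY hp
  have hE : HasGrad (fun q => Real.exp (ε⁻¹ * layerPhase q)) p
      (Real.exp (ε⁻¹ * layerPhase p) * (ε⁻¹ * layerPhaseX p))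
      (Real.exp (ε⁻¹ * layerPhase p) * (ε⁻¹ * layerPhaseY p)) :=
    ((hasGrad_layerPhase hp).const_mul ε⁻¹).comp (Real.hasDerivAt_exp _)
  have hAE := hgA.mul hE
  have hne := eventually_snd_neg hp
  have hle1 : p.1 ^ 2 + p.2 ^ 2 ≤ 1 := le_of_lt h1
  have hE1 := exp_layerPhase_le_one hε hp hle1
  have hE0 := Real.exp_pos (ε⁻¹ * layerPhase p)
  have habs := exp_layerPhase_mul_le hε hp hle1
  have heik := layerPhase_eikonal hp
  have hy1 : |p.2| ≤ 1 := (abs_lt_one_of_mem_unitDisk h1).2.le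
  have hr1 := radius_le_one hle1
  have hA0 : radius p < 1 / 4 → layerAmplitude G δ p = 0 := layerAmplitude_eq_zero hδ0
  refine ⟨_, _, _, _, _, _, hAE.neg.congr_eventuallyEq ?_,
    (hAE.mul hq1).congr_eventuallyEq ?_, (hAE.mul hq2).congr_eventuallyEq ?_, ?_, ?_, ?_⟩
  · filter_upwards [hne] with q hq using if_pos hq
  · filter_upwards [hne] with q hq using if_pos hq
  · filter_upwards [hne] with q hq using if_pos hq
  · rw [layerFlux, if_pos hp]
    set E := Real.exp (ε⁻¹ * layerPhase p)
    have : ε * -(a * E + layerAmplitude G δ p * (E * (ε⁻¹ * layerPhaseX p)))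
        + layerAmplitude G δ p * E * layerPhaseX p = -(ε * (a * E)) := by
      field_simp; ring
    rw [this, abs_neg, abs_mul, abs_mul, abs_of_pos hε, abs_of_pos hE0]
    calc ε * (|a| * E) ≤ ε * (C * 1 * 1) := by gcongr; exact ha.trans (by gcongr)
      _ = ε * C := by ring
  · rw [layerFlux, if_pos hp]
    set E := Real.exp (ε⁻¹ * layerPhase p)
    have : ε * -(b * E + layerAmplitude G δ p * (E * (ε⁻¹ * layerPhaseY p)))
        + layerAmplitude G δ p * E * layerPhaseY p = -(ε * (b * E)) := by
      field_simp; ring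
    rw [this, abs_neg, abs_mul, abs_mul, abs_of_pos hε, abs_of_pos hE0]
    calc ε * (|b| * E) ≤ ε * (C * 1 * 1) := by gcongr; exact hb.trans (by gcongr)
      _ = ε * C := by ring
  · set E := Real.exp (ε⁻¹ * layerPhase p)
    set A := layerAmplitude G δ p
    have hid : (a * E + A * (E * (ε⁻¹ * layerPhaseX p))) * layerPhaseX p + A * E * q₁
        + ((b * E + A * (E * (ε⁻¹ * layerPhaseY p))) * layerPhaseY p + A * E * q₂)
        - -(b * E + A * (E * (ε⁻¹ * layerPhaseY p)))
        = E * (a * layerPhaseX p + b * layerPhaseY p + A * (q₁ + q₂) + b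
          + ε⁻¹ * (A * (layerPhaseX p ^ 2 + layerPhaseY p ^ 2 + layerPhaseY p))) := by ring
    rw [hid, hq, heik]
    have hprof : 0 ≤ layerProfile ε p := by rw [layerProfile]; positivity
    rcases lt_or_ge (radius p) (1 / 4) with hr | hr
    · rw [(hz hr).1, (hz hr).2, hA0 hr]
      simp only [zero_mul, mul_zero, add_zero, abs_zero]
      positivity
    have hX := abs_layerPhaseX_le hp hr
    have hY := abs_layerPhaseY_le hp hr
    have hi0 := inv_pos.2 (radius_pos hp)
    have hi4 : (radius p)⁻¹ ≤ 4 := inv_le_of_inv_le₀ (by norm_num) (by linarith)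
    have hx := (abs_fst_mul_inv_radius_le hp).le
    have hε' := inv_pos.2 hε
    have hA1 : |A| ≤ C := hA.trans (by
      rw [← sq_abs]; nlinarith [abs_nonneg p.2, mul_nonneg hC (abs_nonneg p.2)])
    have t1 : |a * layerPhaseX p| ≤ C * |p.2| * 4 := by rw [abs_mul]; gcongr
    have t2 : |b * layerPhaseY p| ≤ C * |p.2| * 4 := by rw [abs_mul]; gcongr
    have t3 : |A * -(p.2 * (radius p)⁻¹ ^ 3)| ≤ C * (|p.2| * 4 ^ 3) := by
      rw [abs_mul, abs_neg, abs_mul, abs_pow, abs_of_pos hi0]; gcongr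
    have t5 : |ε⁻¹ * (A * (p.1 ^ 2 * (radius p)⁻¹ ^ 4 * (1 - radius p)))|
        ≤ ε⁻¹ * (C * |p.2| ^ 2 * (1 ^ 2 * 4 ^ 2 * (1 - radius p))) := by
      have : p.1 ^ 2 * (radius p)⁻¹ ^ 4 = (p.1 * (radius p)⁻¹) ^ 2 * (radius p)⁻¹ ^ 2 := by ring
      rw [this, abs_mul, abs_mul, abs_mul, abs_mul, abs_pow, abs_pow, abs_of_pos hi0,
        abs_of_pos hε', abs_of_nonneg (sub_nonneg.2 hr1), sq_abs p.2]
      have := sub_nonneg.2 hr1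
      gcongr
    rw [abs_mul, abs_of_pos hE0]
    have tsum : |a * layerPhaseX p + b * layerPhaseY p + A * -(p.2 * (radius p)⁻¹ ^ 3) + b
          + ε⁻¹ * (A * (p.1 ^ 2 * (radius p)⁻¹ ^ 4 * (1 - radius p)))|
        ≤ 73 * C * (|p.2| * (1 + ε⁻¹ * (|p.2| * (1 - radius p)))) := by
      have hn : 0 ≤ C * (|p.2| * (ε⁻¹ * (|p.2| * (1 - radius p)))) := by
        have := sub_nonneg.2 hr1
        positivity
      have := abs_add_le (a * layerPhaseX p + b * layerPhaseY p
        + A * -(p.2 * (radius p)⁻¹ ^ 3) + b)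
        (ε⁻¹ * (A * (p.1 ^ 2 * (radius p)⁻¹ ^ 4 * (1 - radius p))))
      have := abs_add_le (a * layerPhaseX p + b * layerPhaseY p
        + A * -(p.2 * (radius p)⁻¹ ^ 3)) b
      have := abs_add_le (a * layerPhaseX p + b * layerPhaseY p) (A * -(p.2 * (radius p)⁻¹ ^ 3))
      have := abs_add_le (a * layerPhaseX p) (b * layerPhaseY p)
      nlinarith
    calc _ ≤ E * (73 * C * (|p.2| * (1 + ε⁻¹ * (|p.2| * (1 - radius p))))) := by gcongr
      _ = 73 * C * (|p.2| * (E * (1 + ε⁻¹ * (|p.2| * (1 - radius p))))) := by ring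
      _ ≤ 73 * C * (2 * layerProfile ε p) := by gcongr
      _ = 146 * C * layerProfile ε p := by ring

theorem abs_layerFlux_le {C : ℝ} {Q : ℝ × ℝ → ℝ} (hε : 0 < ε) (hC : 0 ≤ C)
    (hδ0 : ∀ η ∈ Icc (3 / 4 : ℝ) 1, δ η = 0)
    (hA : p.2 < 0 → |layerAmplitude G δ p| ≤ C * p.2 ^ 2)
    (hQ : p.2 < 0 → 1 / 4 ≤ radius p → |Q p| ≤ 4)
    (h1 : p.1 ^ 2 + p.2 ^ 2 ≤ 1) : |layerFlux G δ ε Q p| ≤ 4 * C * p.2 ^ 2 := by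
  rw [layerFlux]
  split_ifs with hp
  · rcases lt_or_ge (radius p) (1 / 4) with hr | hr
    · rw [layerAmplitude_eq_zero hδ0 hr, zero_mul, zero_mul, abs_zero]; positivity
    · rw [abs_mul, abs_mul, abs_of_pos (Real.exp_pos _)]
      calc _ ≤ C * p.2 ^ 2 * 1 * 4 := by
            gcongr
            · exact hA hp
            · exact exp_layerPhase_le_one hε hp h1
            · exact hQ hp hr
        _ = _ := by ring
  · rw [abs_zero]; positivity

theorem abs_corrector_le {C : ℝ} (hε : 0 < ε) (hC : 0 ≤ C)
    (hA : p.2 < 0 → |layerAmplitude G δ p| ≤ C * p.2 ^ 2)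
    (h1 : p.1 ^ 2 + p.2 ^ 2 ≤ 1) : |corrector G δ ε p| ≤ C * p.2 ^ 2 := by
  rw [corrector]
  split_ifs with hp
  · rw [abs_neg, abs_mul, abs_of_pos (Real.exp_pos _)]
    exact (mul_le_of_le_one_right (abs_nonneg _) (exp_layerPhase_le_one hε hp h1)).trans (hA hp)
  · rw [abs_zero]; positivity

theorem continuousOn_corrector {C : ℝ} (hε : 0 < ε) (hC : 0 ≤ C)
    (hG : Continuous G) (hδ : Continuous δ)
    (hA : ∀ p : ℝ × ℝ, p.2 < 0 → |layerAmplitude G δ p| ≤ C * p.2 ^ 2) :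
    ContinuousOn (corrector G δ ε) {p : ℝ × ℝ | p.1 ^ 2 + p.2 ^ 2 ≤ 1} := by
  intro p hp
  rcases lt_trichotomy p.2 0 with h | h | h
  · have hr : ContinuousAt radius p := continuous_radius.continuousAt
    have hi : ContinuousAt (fun q => (radius q)⁻¹) p := hr.inv₀ (radius_pos h).ne'
    have hc : ContinuousAt
        (fun q => -(layerAmplitude G δ q * Real.exp (ε⁻¹ * layerPhase q))) p := by
      unfold layerAmplitude layerPhase
      refine ((ContinuousAt.mul (hG.continuousAt.comp (continuous_fst.continuousAt.mul hi))
        (hδ.continuousAt.comp (continuousAt_const.sub hr))).mul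
        (Real.continuous_exp.continuousAt.comp ?_)).neg
      exact continuousAt_const.mul
        ((continuous_snd.continuousAt.mul hi).sub continuous_snd.continuousAt)
    refine (hc.congr ?_).continuousWithinAt
    filter_upwards [eventually_snd_neg h] with q hq using (if_pos hq).symm
  · have hz : corrector G δ ε p = 0 := if_neg (by rw [h]; exact lt_irrefl 0)
    rw [ContinuousWithinAt, hz]
    refine squeeze_zero_norm' (a := fun q : ℝ × ℝ => C * q.2 ^ 2) ?_ ?_
    · filter_upwards [self_mem_nhdsWithin] with q hq
      exact abs_corrector_le hε hC (hA q) hq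
    · have : Continuous fun q : ℝ × ℝ => C * q.2 ^ 2 := by fun_prop
      have := this.tendsto p
      simp only [h] at this
      exact (by simpa using this : Filter.Tendsto _ _ _).mono_left nhdsWithin_le_nhds
  · refine ContinuousAt.continuousWithinAt (continuousAt_const (y := (0 : ℝ)) |>.congr ?_)
    filter_upwards [eventually_snd_pos h] with q hq using (if_neg hq.not_gt).symm

/-- Existence of the gradient bounds and the residual bound for the corrector on the disk. -/
theorem exists_corrector_bound (hδs : ContDiff ℝ 1 δ) {C : ℝ} (hC : 0 ≤ C)
    (hG : ∀ c, |c| ≤ 1 → |G c| ≤ C * (1 - c ^ 2))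
    (hG' : ∀ c, |c| < 1 → ∃ d, |d| ≤ C ∧ HasDerivAt G d c) (hGc : Continuous G)
    (hδr : ∀ η, δ η ∈ Icc (0 : ℝ) 1) (hδ0 : ∀ η ∈ Icc (3 / 4 : ℝ) 1, δ η = 0) :
    ∃ K, 0 ≤ K ∧ ∀ ε, 0 < ε →
      ContinuousOn (corrector G δ ε) {p : ℝ × ℝ | p.1 ^ 2 + p.2 ^ 2 ≤ 1} ∧
      ∃ M₁ M₂ : ℝ × ℝ → ℝ, ∀ p ∈ unitDisk,
        ∃ φx φy m₁ m₁' m₂' m₂, HasGrad (corrector G δ ε) p φx φy ∧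
          HasGrad M₁ p m₁ m₁' ∧ HasGrad M₂ p m₂' m₂ ∧
          |ε * φx + M₁ p| ≤ ε * K ∧ |ε * φy + M₂ p| ≤ ε * K ∧
          |m₁ + m₂ - φy| ≤ K * layerProfile ε p := by
  obtain ⟨D, hD⟩ := (isCompact_Icc (a := (0 : ℝ)) (b := 1)).exists_bound_of_continuousOn
    (hδs.continuous_deriv le_rfl).continuousOn
  have hD0 : 0 ≤ D := (norm_nonneg _).trans (hD 0 (by simp))
  have hδ' : ∀ η ∈ Icc (0 : ℝ) 1, ∃ d, |d| ≤ D ∧ HasDerivAt δ d η := fun η hη =>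
    ⟨_, hD η hη, ((hδs.differentiable one_ne_zero) η).hasDerivAt⟩
  set C' := 64 * C + 16 * C * D with hC'
  have hC'0 : 0 ≤ C' := by positivity
  have hA : ∀ p : ℝ × ℝ, p.2 < 0 → |layerAmplitude G δ p| ≤ C' * p.2 ^ 2 := fun p hp =>
    (abs_layerAmplitude_le hC hG hδr hδ0 hp).trans (by
      have : 16 * C ≤ C' := by rw [hC']; nlinarith [mul_nonneg hC hD0]
      gcongr)
  refine ⟨146 * C', by positivity, fun ε hε => ⟨continuousOn_corrector hε hC'0 hGc hδs.continuous
    hA, layerFlux G δ ε layerPhaseX, layerFlux G δ ε layerPhaseY, fun p hp => ?_⟩⟩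
  have hCK : ε * C' ≤ ε * (146 * C') := by nlinarith
  have hprof : 0 ≤ layerProfile ε p := by rw [layerProfile]; positivity
  rcases lt_trichotomy p.2 0 with h | h | h
  · obtain ⟨a, b, hg, ha, hb, hz⟩ := exists_hasGrad_layerAmplitude hC hD0 hG hG' hδr hδ0 hδ' h hp
    obtain ⟨φx, φy, m₁, m₁', m₂', m₂, h1, h2, h3, h4, h5, h6⟩ :=
      exists_hasGrad_corrector_of_neg hε hC'0 h hp hδ0 (hA p h) hg ha hb hz
    exact ⟨φx, φy, m₁, m₁', m₂', m₂, h1, h2, h3, h4.trans hCK, h5.trans hCK, h6⟩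
  · have hnot : ¬ p.2 < 0 := by rw [h]; exact lt_irrefl 0
    have hz : ∀ Q, layerFlux G δ ε Q p = 0 := fun Q => if_neg hnot
    have hD := isOpen_unitDisk.mem_nhds hp
    refine ⟨0, 0, 0, 0, 0, 0, HasGrad.of_sq_bound (C := C') h ?_,
      HasGrad.of_sq_bound (C := 4 * C') h ?_, HasGrad.of_sq_bound (C := 4 * C') h ?_, ?_, ?_, ?_⟩
    · filter_upwards [hD] with q hq using abs_corrector_le hε hC'0 (hA q) (le_of_lt hq)
    · filter_upwards [hD] with q hq
      exact abs_layerFlux_le hε hC'0 hδ0 (hA q) abs_layerPhaseX_le (le_of_lt hq)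
    · filter_upwards [hD] with q hq
      exact abs_layerFlux_le hε hC'0 hδ0 (hA q) abs_layerPhaseY_le (le_of_lt hq)
    · simp only [hz, mul_zero, add_zero, abs_zero]; positivity
    · simp only [hz, mul_zero, add_zero, abs_zero]; positivity
    · simp only [sub_zero, add_zero, abs_zero]; positivity
  · have hz : ∀ Q, layerFlux G δ ε Q p = 0 := fun Q => if_neg h.not_gt
    refine ⟨0, 0, 0, 0, 0, 0, (HasGrad.const 0).congr_eventuallyEq ?_,
      (HasGrad.const 0).congr_eventuallyEq ?_, (HasGrad.const 0).congr_eventuallyEq ?_, ?_, ?_, ?_⟩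
    · filter_upwards [eventually_snd_pos h] with q hq using if_neg hq.not_gt
    · filter_upwards [eventually_snd_pos h] with q hq using if_neg hq.not_gt
    · filter_upwards [eventually_snd_pos h] with q hq using if_neg hq.not_gt
    · simp only [hz, mul_zero, add_zero, abs_zero]; positivity
    · simp only [hz, mul_zero, add_zero, abs_zero]; positivity
    · simp only [sub_zero, add_zero, abs_zero]; positivity

end Corrector

section Remainder

variable {f u u0 : ℝ × ℝ → ℝ} {δ : ℝ → ℝ} {ε : ℝ}

theorem ContDiffOn.hasGrad_partial (hu : ContDiffOn ℝ 2 u unitDisk) {p : ℝ × ℝ}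
    (hp : p ∈ unitDisk) : HasGrad u p (partialX u p) (partialY u p) := by
  have hd : DifferentiableAt ℝ u p :=
    (hu.differentiableOn two_ne_zero p hp).differentiableAt (isOpen_unitDisk.mem_nhds hp)
  have h := HasGrad.of_hasFDerivAt hd.hasFDerivAt
  exact h.congr_grad h.partialX_eq.symm h.partialY_eq.symm

theorem ContDiffOn.exists_hasGrad_partial_partial (hu : ContDiffOn ℝ 2 u unitDisk) {p : ℝ × ℝ}
    (hp : p ∈ unitDisk) :
    (∃ b, HasGrad (partialX u) p (partialX (partialX u) p) b) ∧
      ∃ a, HasGrad (partialY u) p a (partialY (partialY u) p) := by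
  have hd : DifferentiableAt ℝ (fderiv ℝ u) p :=
    ((hu.fderiv_of_isOpen isOpen_unitDisk (m := 1) (by norm_num)).differentiableOn one_ne_zero
      p hp).differentiableAt (isOpen_unitDisk.mem_nhds hp)
  have hv : ∀ v, HasFDerivAt (fun q => fderiv ℝ u q v) ((fderiv ℝ (fderiv ℝ u) p).flip v) p :=
    fun v => by simpa using hd.hasFDerivAt.clm_apply (hasFDerivAt_const v p)
  have hD := isOpen_unitDisk.mem_nhds hp
  have hX := (HasGrad.of_hasFDerivAt (hv (1, 0))).congr_eventuallyEq (v := partialX u) (by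
    filter_upwards [hD] with q hq using (hu.hasGrad_partial hq).fderiv_fst.symm)
  have hY := (HasGrad.of_hasFDerivAt (hv (0, 1))).congr_eventuallyEq (v := partialY u) (by
    filter_upwards [hD] with q hq using (hu.hasGrad_partial hq).fderiv_snd.symm)
  exact ⟨⟨_, hX.congr_grad hX.partialX_eq.symm rfl⟩, _, hY.congr_grad rfl hY.partialY_eq.symm⟩

/-- The remainder extended by zero outside the disk is continuous. -/
theorem continuous_indicator_remainder (hu0c : Continuous u0)
    (hu0 : ∀ p : ℝ × ℝ, u0 p = ∫ s in p.2..√(1 - p.1 ^ 2), f (p.1, s))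
    (hδ1 : δ 0 = 1)
    (hφ : ContinuousOn (corrector (fun c => u0 (c, -√(1 - c ^ 2))) δ ε)
      {p : ℝ × ℝ | p.1 ^ 2 + p.2 ^ 2 ≤ 1})
    (huc : ContinuousOn u {p : ℝ × ℝ | p.1 ^ 2 + p.2 ^ 2 ≤ 1})
    (hub : ∀ p : ℝ × ℝ, p.1 ^ 2 + p.2 ^ 2 = 1 → u p = 0) :
    Continuous (unitDisk.indicator
      fun p => u p - u0 p - corrector (fun c => u0 (c, -√(1 - c ^ 2))) δ ε p) := by
  have hcl : closure unitDisk ⊆ {p : ℝ × ℝ | p.1 ^ 2 + p.2 ^ 2 ≤ 1} :=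
    closure_lt_subset_le (by fun_prop) (by fun_prop)
  refine continuous_indicator (fun p hp => ?_)
    (((huc.sub hu0c.continuousOn).sub hφ).mono hcl)
  have hp1 : p.1 ^ 2 + p.2 ^ 2 = 1 := frontier_lt_subset_eq (by fun_prop) (by fun_prop) hp
  rw [hub p hp1]
  by_cases hy : p.2 < 0
  · have hr : radius p = 1 := by rw [radius, hp1, Real.sqrt_one]
    have hs : -√(1 - p.1 ^ 2) = p.2 := by
      rw [show 1 - p.1 ^ 2 = p.2 ^ 2 by linarith, Real.sqrt_sq_eq_abs, abs_of_neg hy, neg_neg]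
    simp [corrector, hy, layerAmplitude, layerPhase, hr, hs, hδ1]
  · have hs : √(1 - p.1 ^ 2) = p.2 := by
      rw [show 1 - p.1 ^ 2 = p.2 ^ 2 by linarith, Real.sqrt_sq (not_lt.1 hy)]
    rw [corrector, if_neg hy, hu0, hs, intervalIntegral.integral_same]
    ring

/-- The energy estimate for the remainder, uniformly in the diffusion parameter. -/
theorem exists_remainder_energy_le (hf : ContDiff ℝ 1 f) (h1 : f (1, 0) = 0) (h2 : f (-1, 0) = 0)
    (hu0 : ∀ p : ℝ × ℝ, u0 p = ∫ s in p.2..√(1 - p.1 ^ 2), f (p.1, s))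
    (hδs : ContDiff ℝ 1 δ) (hδr : ∀ η, δ η ∈ Icc (0 : ℝ) 1) (hδ1 : δ 0 = 1)
    (hδ0 : ∀ η ∈ Icc (3 / 4 : ℝ) 1, δ η = 0) :
    ∃ K, 0 ≤ K ∧ ∀ ε ∈ Ioc (0 : ℝ) 1, ∀ u : ℝ × ℝ → ℝ, ContDiffOn ℝ 2 u unitDisk →
      ContinuousOn u {p : ℝ × ℝ | p.1 ^ 2 + p.2 ^ 2 ≤ 1} →
      (∀ p ∈ unitDisk,
        -ε * (partialX (partialX u) p + partialY (partialY u) p) - partialY u p = f p) →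
      (∀ p : ℝ × ℝ, p.1 ^ 2 + p.2 ^ 2 = 1 → u p = 0) →
      ∃ wx wy : ℝ × ℝ → ℝ,
        (∀ p ∈ unitDisk, HasGrad
          (fun p => u p - u0 p - corrector (fun c => u0 (c, -√(1 - c ^ 2))) δ ε p)
          p (wx p) (wy p)) ∧
        ∫⁻ p in unitDisk, ENNReal.ofReal (ε / 2 * (wx p ^ 2 + wy p ^ 2)
          + (u p - u0 p - corrector (fun c => u0 (c, -√(1 - c ^ 2))) δ ε p) ^ 2 / 4)
          ≤ ENNReal.ofReal (K * ε) := by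
  have hu0c := continuous_limitSolution hf hu0
  obtain ⟨C₀, hC₀, hlim⟩ := exists_hasGrad_limitSolution hf h1 h2 hu0
  obtain ⟨C₁, hC₁, hG, hG'⟩ := exists_bound_limitSolution_trace hf h1 h2 hu0
  obtain ⟨C₂, hC₂, hcor⟩ := exists_corrector_bound (G := fun c => u0 (c, -√(1 - c ^ 2))) hδs hC₁
    hG hG' (hu0c.comp (by fun_prop)) hδr hδ0
  refine ⟨44 * (C₀ + C₂) ^ 2 + 864 * C₂ ^ 2, by positivity, fun ε hε u hu huc hpde hub => ?_⟩
  obtain ⟨hφc, M₁, M₂, hM⟩ := hcor ε hε.1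
  have hM' : ∀ p : ℝ × ℝ, ∃ φx φy m₁ m₁' m₂' m₂ g : ℝ, p ∈ unitDisk →
      HasGrad (corrector (fun c => u0 (c, -√(1 - c ^ 2))) δ ε) p φx φy ∧
          HasGrad M₁ p m₁ m₁' ∧ HasGrad M₂ p m₂' m₂ ∧
          |ε * φx + M₁ p| ≤ ε * C₂ ∧ |ε * φy + M₂ p| ≤ ε * C₂ ∧
          |m₁ + m₂ - φy| ≤ C₂ * layerProfile ε p ∧ |f p| ≤ C₀ ∧ |g| ≤ C₀ ∧
          HasGrad u0 p g (-f p) := fun p => by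
    by_cases hp : p ∈ unitDisk
    · obtain ⟨φx, φy, m₁, m₁', m₂', m₂, h⟩ := hM p hp
      obtain ⟨hfp, g, hg⟩ := hlim p hp
      exact ⟨φx, φy, m₁, m₁', m₂', m₂, g, fun _ => ⟨h.1, h.2.1, h.2.2.1, h.2.2.2.1, h.2.2.2.2.1,
        h.2.2.2.2.2, hfp, hg⟩⟩
    · exact ⟨0, 0, 0, 0, 0, 0, 0, fun h => absurd h hp⟩
  choose φx φy m₁ m₁' m₂' m₂ g hall using hM'
  set w : ℝ × ℝ → ℝ := fun p => u p - u0 p - corrector (fun c => u0 (c, -√(1 - c ^ 2))) δ ε p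
    with hw
  have hgw : ∀ p ∈ unitDisk, HasGrad w p (partialX u p - g p - φx p)
      (partialY u p - -f p - φy p) := fun p hp => by
    obtain ⟨h1, -, -, -, -, -, -, -, h9⟩ := hall p hp
    exact ((hu.hasGrad_partial hp).sub h9).sub h1
  refine ⟨_, _, hgw, ?_⟩
  have hen := energy_le (w := unitDisk.indicator w) (wx := fun p => partialX u p - g p - φx p)
    (wy := fun p => partialY u p - -f p - φy p)
    (X₁ := fun p => ε * partialX u p + M₁ p) (X₂ := fun p => ε * partialY u p + M₂ p)
    (a := fun p => ε * partialX (partialX u) p + m₁ p)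
    (b := fun p => ε * partialY (partialY u) p + m₂ p)
    (ρ := fun p => C₂ * layerProfile ε p) (C := C₀ + C₂)
    hε.1 hε.2 (by positivity)
    (continuous_indicator_remainder hu0c hu0 hδ1 hφc huc hub)
    (fun p hp => indicator_of_notMem hp _)
    (fun p hp => (hgw p hp).congr_eventuallyEq (by
      filter_upwards [isOpen_unitDisk.mem_nhds hp] with q hq using indicator_of_mem hq _))
    (fun p hp => by
      obtain ⟨-, h2, -⟩ := hall p hp
      obtain ⟨b, hb⟩ := (hu.exists_hasGrad_partial_partial hp).1
      exact ⟨_, (hb.const_mul ε).add h2⟩)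
    (fun p hp => by
      obtain ⟨-, -, h3, -⟩ := hall p hp
      obtain ⟨a, ha⟩ := (hu.exists_hasGrad_partial_partial hp).2
      exact ⟨_, (ha.const_mul ε).add h3⟩)
    (fun p hp => by
      obtain ⟨-, -, -, h4, -, -, -, h8, -⟩ := hall p hp
      have : ε * partialX u p + M₁ p - ε * (partialX u p - g p - φx p)
          = ε * g p + (ε * φx p + M₁ p) := by ring
      rw [this, mul_add]
      refine (abs_add_le _ _).trans (add_le_add ?_ h4)
      rw [abs_mul, abs_of_pos hε.1]
      exact mul_le_mul_of_nonneg_left h8 hε.1.le)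
    (fun p hp => by
      obtain ⟨-, -, -, -, h5, -, h7, -, -⟩ := hall p hp
      have : ε * partialY u p + M₂ p - ε * (partialY u p - -f p - φy p)
          = -(ε * f p) + (ε * φy p + M₂ p) := by ring
      rw [this, mul_add]
      refine (abs_add_le _ _).trans (add_le_add ?_ h5)
      rw [abs_neg, abs_mul, abs_of_pos hε.1]
      exact mul_le_mul_of_nonneg_left h7 hε.1.le)
    (fun p hp => by
      obtain ⟨-, -, -, -, -, h6, -⟩ := hall p hp
      have : ε * partialX (partialX u) p + m₁ p + (ε * partialY (partialY u) p + m₂ p)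
          + (partialY u p - -f p - φy p) = m₁ p + m₂ p - φy p := by
        linarith [hpde p hp]
      rwa [this])
    (continuous_const.mul (continuous_layerProfile ε))
  have hcongr : ∫⁻ p in unitDisk, ENNReal.ofReal (ε / 2 * ((partialX u p - g p - φx p) ^ 2
      + (partialY u p - -f p - φy p) ^ 2) + w p ^ 2 / 4)
      = ∫⁻ p in unitDisk, ENNReal.ofReal (ε / 2 * ((partialX u p - g p - φx p) ^ 2
      + (partialY u p - -f p - φy p) ^ 2) + unitDisk.indicator w p ^ 2 / 4) := by
    refine setLIntegral_congr_fun measurableSet_unitDisk fun p hp => ?_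
    simp only [indicator_of_mem hp]
  refine hcongr.trans_le (hen.trans (ENNReal.ofReal_le_ofReal ?_))
  have hcp : Continuous fun p => 18 * (C₂ * layerProfile ε p) ^ 2 :=
    continuous_const.mul ((continuous_const.mul (continuous_layerProfile ε)).pow 2)
  rw [integral_add (integrableOn_unitDisk_of_continuous continuous_const)
    (integrableOn_unitDisk_of_continuous hcp), setIntegral_const]
  have hvol : volume.real unitDisk ≤ 4 :=
    ENNReal.toReal_le_of_le_ofReal (by norm_num) (by simpa using volume_unitDisk_le)
  have hI : ∫ p in unitDisk, 18 * (C₂ * layerProfile ε p) ^ 2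
      = 18 * C₂ ^ 2 * ∫ p in unitDisk, layerProfile ε p ^ 2 := by
    rw [← integral_const_mul]
    congr 1
    funext p
    ring
  rw [hI, smul_eq_mul]
  calc _ ≤ 4 * (11 * (C₀ + C₂) ^ 2 * ε) + 18 * C₂ ^ 2 * (48 * ε) := by
        have := hε.1
        gcongr
        exact setIntegral_layerProfile_sq_le hε.1
    _ = _ := by ring

end Remainder

theorem integral_le_of_lintegral_le {α : Type*} [MeasurableSpace α] {μ : Measure α} {F g : α → ℝ}
    {c B : ℝ} (hc : 0 ≤ c) (hB : 0 ≤ B) (hF : ∀ᵐ x ∂μ, 0 ≤ F x) (hFg : ∀ᵐ x ∂μ, F x ≤ c * g x)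
    (hg : ∫⁻ x, ENNReal.ofReal (g x) ∂μ ≤ ENNReal.ofReal B) : ∫ x, F x ∂μ ≤ c * B := by
  by_cases hi : Integrable F μ
  · rw [← ENNReal.ofReal_le_ofReal_iff (by positivity), ofReal_integral_eq_lintegral_ofReal hi hF]
    calc ∫⁻ x, ENNReal.ofReal (F x) ∂μ
        ≤ ∫⁻ x, ENNReal.ofReal c * ENNReal.ofReal (g x) ∂μ := by
          refine lintegral_mono_ae ?_
          filter_upwards [hFg] with x hx
          rw [← ENNReal.ofReal_mul hc]
          exact ENNReal.ofReal_le_ofReal hx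
      _ = ENNReal.ofReal c * ∫⁻ x, ENNReal.ofReal (g x) ∂μ :=
          lintegral_const_mul' _ _ ENNReal.ofReal_ne_top
      _ ≤ ENNReal.ofReal c * ENNReal.ofReal B := by gcongr
      _ = ENNReal.ofReal (c * B) := (ENNReal.ofReal_mul hc).symm
  · rw [integral_undef hi]; positivity

/-- A function given by the corrector formula in polar coordinates is the corrector away from the
origin. -/
theorem eq_corrector_of_polar {f u0 φ : ℝ × ℝ → ℝ} {δ : ℝ → ℝ} {ε : ℝ}
    (hu0 : ∀ p : ℝ × ℝ, u0 p = ∫ s in p.2..√(1 - p.1 ^ 2), f (p.1, s))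
    (hφ : ∀ η ∈ Ico (0 : ℝ) 1, ∀ τ ∈ Icc (0 : ℝ) (2 * π),
        φ ((1 - η) * Real.cos τ, (1 - η) * Real.sin τ)
          = -u0 (Real.cos τ, Real.sin τ) * Real.exp (Real.sin τ * η / ε) *
              (if τ ∈ Icc π (2 * π) then (1 : ℝ) else 0) * δ η)
    {p : ℝ × ℝ} (hp : p ∈ unitDisk) (hp0 : p ≠ 0) :
    φ p = corrector (fun c => u0 (c, -√(1 - c ^ 2))) δ ε p := by
  have hr1 : radius p ≤ 1 := radius_le_one (le_of_lt hp)
  have hr0 : 0 < radius p := by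
    refine (radius_nonneg p).lt_of_ne' fun h => hp0 ?_
    have h2 := radius_sq p
    rw [h] at h2
    ext <;> simp only [Prod.fst_zero, Prod.snd_zero] <;>
      nlinarith [sq_nonneg p.1, sq_nonneg p.2]
  set c := p.1 * (radius p)⁻¹ with hc
  have hcr : radius p * c = p.1 := by rw [hc]; field_simp
  have hs2 : 1 - c ^ 2 = (p.2 * (radius p)⁻¹) ^ 2 := by
    rw [hc]
    field_simp
    rw [radius_sq]
    ring
  have hc1 : |c| ≤ 1 := by
    rw [← sq_le_one_iff_abs_le_one]
    nlinarith [sq_nonneg (p.2 * (radius p)⁻¹)]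
  have hcos : Real.cos (Real.arccos c) = c := Real.cos_arccos (abs_le.1 hc1).1 (abs_le.1 hc1).2
  have hη : 1 - radius p ∈ Ico (0 : ℝ) 1 := ⟨by linarith, by linarith⟩
  have ha0 := Real.arccos_nonneg c
  have haπ := Real.arccos_le_pi c
  by_cases hy : p.2 < 0
  · have hsq : -√(1 - c ^ 2) = p.2 * (radius p)⁻¹ := by
      rw [hs2, Real.sqrt_sq_eq_abs, abs_of_neg (mul_neg_of_neg_of_pos hy (inv_pos.2 hr0)), neg_neg]
    have h := hφ (1 - radius p) hη (2 * π - Real.arccos c) ⟨by linarith, by linarith⟩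
    rw [Real.cos_two_pi_sub, Real.sin_two_pi_sub, hcos, Real.sin_arccos, hsq, sub_sub_cancel, hcr,
      if_pos ⟨by linarith, by linarith⟩,
      show radius p * (p.2 * (radius p)⁻¹) = p.2 by field_simp] at h
    rw [corrector, if_pos hy, layerAmplitude, layerPhase, ← hc, hsq]
    rw [show (p.1, p.2) = p from rfl] at h
    rw [h, show p.2 * (radius p)⁻¹ * (1 - radius p) / ε = ε⁻¹ * (p.2 * (radius p)⁻¹ - p.2) by
      field_simp]
    ring
  · have hsq : √(1 - c ^ 2) = p.2 * (radius p)⁻¹ := by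
      rw [hs2, Real.sqrt_sq (mul_nonneg (not_lt.1 hy) (inv_pos.2 hr0).le)]
    have h := hφ (1 - radius p) hη (Real.arccos c) ⟨by linarith, by linarith [Real.pi_pos]⟩
    have hz : u0 (c, √(1 - c ^ 2)) = 0 := by rw [hu0, intervalIntegral.integral_same]
    rw [hcos, Real.sin_arccos, hz, hsq, sub_sub_cancel, hcr,
      show radius p * (p.2 * (radius p)⁻¹) = p.2 by field_simp] at h
    rw [corrector, if_neg hy, show p = (p.1, p.2) from rfl, h]
    ring

/-- convergence theorem on the unit disk. Under the compatibility
conditions on `f` at the characteristic points `(±1,0)`, with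
`u⁰(x,y) = ∫_y^{√(1-x²)} f(x,s) ds` and the approximate corrector `φ̄⁰` defined
in boundary-fitted polar coordinates `x = (1-η)cos τ`, `y = (1-η)sin τ` by
`φ̄⁰ = -u⁰(cos τ, sin τ)·exp(sin(τ)·η/ε)·χ_{[π,2π]}(τ)·δ(η)`, every classical
solution `u^ε` of `-εΔu^ε - ∂_y u^ε = f`, `u^ε|∂Ω = 0` satisfies
`‖u^ε - u⁰ - φ̄⁰‖_{L²(Ω)} + √ε‖u^ε - u⁰ - φ̄⁰‖_{H¹(Ω)} ≤ κ√ε`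
with `κ` independent of `ε ∈ (0,1]`. -/
theorem stmt6 (f : ℝ × ℝ → ℝ) (hf : ContDiff ℝ (⊤ : ℕ∞) f)
    (hcompat : ∀ p₁ p₂ : ℕ, 2 * p₁ + p₂ ≤ 2 →
      deriv^[p₁] (fun x => deriv^[p₂] (fun y => f (x, y)) 0) 1 = 0 ∧
      deriv^[p₁] (fun x => deriv^[p₂] (fun y => f (x, y)) 0) (-1) = 0)
    (u0 : ℝ × ℝ → ℝ)
    (hu0 : ∀ p : ℝ × ℝ, u0 p = ∫ s in p.2..(Real.sqrt (1 - p.1 ^ 2)), f (p.1, s))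
    (δ : ℝ → ℝ) (hδsmooth : ContDiff ℝ (⊤ : ℕ∞) δ)
    (hδrange : ∀ η : ℝ, δ η ∈ Icc (0 : ℝ) 1)
    (hδ1 : ∀ η ∈ Icc (0 : ℝ) (1 / 2), δ η = 1)
    (hδ0 : ∀ η ∈ Icc (3 / 4 : ℝ) 1, δ η = 0) :
    ∃ κ > (0 : ℝ), ∀ ε ∈ Ioc (0 : ℝ) 1, ∀ φ : ℝ × ℝ → ℝ,
      (∀ η ∈ Ico (0 : ℝ) 1, ∀ τ ∈ Icc (0 : ℝ) (2 * π),
        φ ((1 - η) * Real.cos τ, (1 - η) * Real.sin τ)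
          = -u0 (Real.cos τ, Real.sin τ) * Real.exp (Real.sin τ * η / ε) *
              (if τ ∈ Icc π (2 * π) then (1 : ℝ) else 0) * δ η) →
      ∀ u : ℝ × ℝ → ℝ,
        ContDiffOn ℝ 2 u {p : ℝ × ℝ | p.1 ^ 2 + p.2 ^ 2 < 1} →
        ContinuousOn u {p : ℝ × ℝ | p.1 ^ 2 + p.2 ^ 2 ≤ 1} →
        (∀ p : ℝ × ℝ, p.1 ^ 2 + p.2 ^ 2 < 1 →
          -ε * (partialX (partialX u) p + partialY (partialY u) p) - partialY u p = f p) →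
        (∀ p : ℝ × ℝ, p.1 ^ 2 + p.2 ^ 2 = 1 → u p = 0) →
        L2norm (fun p => u p - u0 p - φ p) {p : ℝ × ℝ | p.1 ^ 2 + p.2 ^ 2 < 1}
          + Real.sqrt ε *
            H1norm (fun p => u p - u0 p - φ p) {p : ℝ × ℝ | p.1 ^ 2 + p.2 ^ 2 < 1}
          ≤ κ * Real.sqrt ε := by
  have hf1 : ContDiff ℝ 1 f := hf.of_le (by exact_mod_cast le_top)
  have hδs : ContDiff ℝ 1 δ := hδsmooth.of_le (by exact_mod_cast le_top)
  have h00 := hcompat 0 0 (by norm_num)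
  simp only [Function.iterate_zero, id_eq] at h00
  obtain ⟨K, hK, hmain⟩ := exists_remainder_energy_le hf1 h00.1 h00.2 hu0 hδs hδrange
    (hδ1 0 (by norm_num)) hδ0
  refine ⟨√(4 * K) + √(6 * K) + 1, by positivity, fun ε hε φ hφ u hu huc hpde hub => ?_⟩
  obtain ⟨wx, wy, hgw, henergy⟩ := hmain ε hε u hu huc hpde hub
  have hε0 := hε.1
  change L2norm _ unitDisk + √ε * H1norm _ unitDisk ≤ _
  have hgrad : ∀ᵐ p ∂(volume.restrict unitDisk), φ p
      = corrector (fun c => u0 (c, -√(1 - c ^ 2))) δ ε p ∧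
      HasGrad (fun p => u p - u0 p - φ p) p (wx p) (wy p) := by
    have h0 : ∀ᵐ p ∂(volume.restrict unitDisk), p ≠ (0 : ℝ × ℝ) :=
      ae_restrict_of_ae (Measure.ae_ne volume 0)
    filter_upwards [h0, ae_restrict_mem measurableSet_unitDisk] with p hp0 hp
    refine ⟨eq_corrector_of_polar hu0 hφ hp hp0, (hgw p hp).congr_eventuallyEq ?_⟩
    filter_upwards [isOpen_unitDisk.mem_nhds hp, isOpen_ne.mem_nhds hp0] with q hq hq0
    rw [eq_corrector_of_polar hu0 hφ hq hq0]
  have hL2 : ∫ p in unitDisk, (u p - u0 p - φ p) ^ 2 ≤ 4 * (K * ε) := by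
    refine integral_le_of_lintegral_le (by norm_num) (by positivity)
      (Filter.Eventually.of_forall fun p => sq_nonneg _) ?_ henergy
    filter_upwards [hgrad] with p hp
    rw [hp.1]
    have : 0 ≤ ε / 2 * (wx p ^ 2 + wy p ^ 2) := by positivity
    linarith
  have hH1 : ∫ p in unitDisk, ((u p - u0 p - φ p) ^ 2
      + partialX (fun p => u p - u0 p - φ p) p ^ 2
      + partialY (fun p => u p - u0 p - φ p) p ^ 2) ≤ 6 / ε * (K * ε) := by
    refine integral_le_of_lintegral_le (by positivity) (by positivity)
      (Filter.Eventually.of_forall fun p => by positivity) ?_ henergy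
    filter_upwards [hgrad] with p hp
    rw [hp.2.partialX_eq, hp.2.partialY_eq, hp.1]
    set w := u p - u0 p - corrector (fun c => u0 (c, -√(1 - c ^ 2))) δ ε p
    have h1 : 6 / ε * (ε / 2 * (wx p ^ 2 + wy p ^ 2) + w ^ 2 / 4)
        = 3 * (wx p ^ 2 + wy p ^ 2) + 3 / 2 * (w ^ 2 / ε) := by field_simp; ring
    have h2 : w ^ 2 ≤ w ^ 2 / ε := le_div_self (sq_nonneg w) hε0 hε.2
    rw [h1]
    nlinarith [sq_nonneg (wx p), sq_nonneg (wy p), sq_nonneg w]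
  rw [show 6 / ε * (K * ε) = 6 * K by field_simp] at hH1
  have hL2' : L2norm (fun p => u p - u0 p - φ p) unitDisk ≤ √(4 * K) * √ε := by
    rw [L2norm, ← Real.sqrt_eq_rpow, ← Real.sqrt_mul (by positivity)]
    exact Real.sqrt_le_sqrt (hL2.trans_eq (by ring))
  have hH1' : H1norm (fun p => u p - u0 p - φ p) unitDisk ≤ √(6 * K) := by
    rw [H1norm, ← Real.sqrt_eq_rpow]
    exact Real.sqrt_le_sqrt hH1
  have := mul_le_mul_of_nonneg_left hH1' (Real.sqrt_nonneg ε)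
  nlinarith [Real.sqrt_nonneg ε]
end

section
/- Let p ≥ 1 be a real number, and let A > 0, R > 0, ε > 0. Then ∫_π^{2π} ∫_0^R (-sin τ)^p · exp(p·A·sin(τ)·η/ε) dη dτ ≤ π·ε/(p·A). -/
open Real

/-- The exponential layer weighted by `s ^ p` has mass at most `1 / c`, uniformly in its length. -/
lemma abs_integral_rpow_mul_exp_neg_le {p c s R : ℝ} (hp : 1 ≤ p) (hc : 0 < c)
    (hs₀ : 0 ≤ s) (hs₁ : s ≤ 1) (hR : 0 ≤ R) :
    |∫ η in (0 : ℝ)..R, s ^ p * Real.exp (-(c * s) * η)| ≤ 1 / c := by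
  have hnonneg : 0 ≤ ∫ η in (0 : ℝ)..R, s ^ p * Real.exp (-(c * s) * η) :=
    intervalIntegral.integral_nonneg hR fun η _ => by positivity
  rw [abs_of_nonneg hnonneg]
  rcases hs₀.eq_or_lt with rfl | hs
  · simp [Real.zero_rpow (by linarith : p ≠ 0), hc.le]
  · have hcs : 0 < c * s := mul_pos hc hs
    have hpow : s ^ p ≤ s := by
      simpa using Real.rpow_le_rpow_of_exponent_ge hs hs₁ hp
    have hexp : ∫ η in (0 : ℝ)..R, Real.exp (-(c * s) * η)
        = (1 - Real.exp (-(c * s) * R)) / (c * s) := by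
      rw [intervalIntegral.integral_comp_mul_left _ (neg_ne_zero.mpr hcs.ne'), integral_exp]
      simp only [mul_zero, Real.exp_zero, smul_eq_mul]
      field_simp
      ring
    have hbound : (1 - Real.exp (-(c * s) * R)) / (c * s) ≤ 1 / (c * s) := by
      gcongr
      linarith [Real.exp_pos (-(c * s) * R)]
    rw [intervalIntegral.integral_const_mul, hexp]
    calc s ^ p * ((1 - Real.exp (-(c * s) * R)) / (c * s))
        ≤ s ^ p * (1 / (c * s)) := by gcongr
      _ ≤ s * (1 / (c * s)) := by gcongr
      _ = 1 / c := by field_simp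

/-- key integral estimate for the corrector `L^p` bounds:
for real `p ≥ 1` and `A, R, ε > 0`,
`∫_π^{2π} ∫_0^R (-sin τ)^p · exp(p·A·sin(τ)·η/ε) dη dτ ≤ π·ε/(p·A)`. -/
theorem stmt8 (p A R ε : ℝ) (hp : 1 ≤ p) (hA : 0 < A) (hR : 0 < R) (hε : 0 < ε) :
    (∫ τ in π..(2 * π), ∫ η in (0 : ℝ)..R,
        (-Real.sin τ) ^ p * Real.exp (p * A * Real.sin τ * η / ε))
      ≤ π * ε / (p * A) := by
  have hp₀ : 0 < p := by linarith
  have hc : 0 < p * A / ε := by positivity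
  have hinner : ∀ τ ∈ Set.uIoc π (2 * π), ‖∫ η in (0 : ℝ)..R,
      (-Real.sin τ) ^ p * Real.exp (p * A * Real.sin τ * η / ε)‖ ≤ 1 / (p * A / ε) := by
    intro τ hτ
    rw [Set.uIoc_of_le (by linarith [Real.pi_pos])] at hτ
    have hsin : 0 ≤ -Real.sin τ := by
      rw [← Real.sin_sub_pi]
      exact Real.sin_nonneg_of_nonneg_of_le_pi (by linarith [hτ.1]) (by linarith [hτ.2])
    have hexponent : ∀ η, p * A * Real.sin τ * η / ε = -(p * A / ε * -Real.sin τ) * η :=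
      fun η => by ring
    simp only [hexponent, Real.norm_eq_abs]
    exact abs_integral_rpow_mul_exp_neg_le hp hc hsin (by linarith [Real.neg_one_le_sin τ]) hR.le
  refine (le_abs_self _).trans
    ((intervalIntegral.norm_integral_le_of_norm_le_const hinner).trans_eq ?_)
  rw [show 2 * π - π = π by ring, abs_of_pos Real.pi_pos]
  field_simp
end

section
/- Let A > 0, R > 0, p ∈ [1, ∞), M ≥ 0, and let s, n, l ≥ 0 be integers with s ≤ l + n + 1. Let g : [π, 2π] → ℝ be measurable with |g(τ)| ≤ M·(-sin τ)^{l+n+1-s} for all τ ∈ [π, 2π]. Then there exists a constant κ > 0, depending only on A, R, p, s, n, l (but not on ε, g, or M), such that for every ε ∈ (0,1], ( ∫_π^{2π} ∫_0^R | (-sin τ)^{-l} · (η/ε)^n · g(τ) · (A·sin(τ)/ε)^s · exp(A·sin(τ)·η/ε) |^p dη dτ )^{1/p} ≤ κ·M·ε^{1/p - s}. Note that g(τ)·(A·sin(τ)/ε)^s·exp(A·sin(τ)·η/ε) is exactly the s-th η-derivative of the corrector profile φ⁰(η,τ) = g(τ)·exp(A·sin(τ)·η/ε). -/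
open Real

/-- Half of the exponential decay absorbs a polynomial factor. -/
lemma pow_mul_exp_neg_le {A x : ℝ} (hA : 0 < A) (hx : 0 ≤ x) (n : ℕ) :
    x ^ n * exp (-(A * x)) ≤ n.factorial * (2 / A) ^ n * exp (-(A / 2 * x)) := by
  have h := Real.pow_div_factorial_le_exp (A / 2 * x) (by positivity) n
  rw [div_le_iff₀ (by positivity)] at h
  have hxn : x ^ n = (2 / A) ^ n * (A / 2 * x) ^ n := by
    rw [← mul_pow]
    congr 1
    field_simp
  have he : exp (-(A * x)) = exp (-(A / 2 * x)) * exp (-(A / 2 * x)) := by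
    rw [← exp_add]
    congr 1
    ring
  have h1 : exp (A / 2 * x) * exp (-(A / 2 * x)) = 1 := by
    rw [← exp_add]
    simp
  calc x ^ n * exp (-(A * x))
      = (2 / A) ^ n * (A / 2 * x) ^ n * (exp (-(A / 2 * x)) * exp (-(A / 2 * x))) := by
        rw [he, hxn]
    _ ≤ (2 / A) ^ n * (exp (A / 2 * x) * n.factorial) *
          (exp (-(A / 2 * x)) * exp (-(A / 2 * x))) := by gcongr
    _ = n.factorial * (2 / A) ^ n * exp (-(A / 2 * x)) *
          (exp (A / 2 * x) * exp (-(A / 2 * x))) := by ring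
    _ = _ := by rw [h1, mul_one]

lemma integral_mul_exp_neg_le {b : ℝ} (hb : 0 < b) (σ R : ℝ) :
    ∫ η in (0 : ℝ)..R, σ * exp (-(b * (σ * η))) ≤ 1 / b := by
  have hderiv : ∀ η ∈ Set.uIcc 0 R,
      HasDerivAt (fun η => -(1 / b) * exp (-(b * (σ * η)))) (σ * exp (-(b * (σ * η)))) η := by
    intro η _
    have h := ((((hasDerivAt_id η).const_mul σ).const_mul b).neg.exp).const_mul (-(1 / b))
    refine h.congr_deriv ?_
    simp only [id, Pi.neg_apply]
    field_simp
  rw [intervalIntegral.integral_eq_sub_of_hasDerivAt hderiv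
    (Continuous.intervalIntegrable (by fun_prop) _ _)]
  have : 0 < 1 / b * exp (-(b * (σ * R))) := by positivity
  simp only [mul_zero, neg_zero, exp_zero]
  linarith

/-- Pointwise bound on the weighted normal derivative of the corrector, where `-σ` is
the value of the sine. -/
lemma abs_weighted_corrector_le {A M ε σ η y : ℝ} (hA : 0 < A) (hM : 0 ≤ M) (hε : 0 < ε)
    (hσ : 0 ≤ σ) (hη : 0 ≤ η) {s n l : ℕ} (hs : s ≤ l + n + 1)
    (hy : |y| ≤ M * σ ^ (l + n + 1 - s)) :
    |(-σ) ^ (-(l : ℤ)) * (η / ε) ^ n * y * (A * -σ / ε) ^ s * exp (A * -σ * η / ε)| ≤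
      (M * A ^ s * (n.factorial * (2 / A) ^ n) / ε ^ s) *
        (σ * exp (-(A / 2 / ε * (σ * η)))) := by
  have hcancel : (σ ^ l)⁻¹ * σ ^ l ≤ 1 := inv_mul_le_one
  have hexp : exp (A * -σ * η / ε) = exp (-(A * (σ * η / ε))) := by
    congr 1
    ring
  have hpow : σ ^ (l + n + 1 - s) * σ ^ s = σ ^ l * (σ * σ ^ n) := by
    rw [← pow_add, Nat.sub_add_cancel hs]
    ring
  calc |(-σ) ^ (-(l : ℤ)) * (η / ε) ^ n * y * (A * -σ / ε) ^ s * exp (A * -σ * η / ε)|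
      = (σ ^ l)⁻¹ * (η / ε) ^ n * |y| * (A * σ / ε) ^ s * exp (-(A * (σ * η / ε))) := by
        rw [hexp]
        simp only [abs_mul, abs_pow, abs_div, abs_neg, abs_exp, zpow_neg, zpow_natCast, abs_inv,
          abs_of_nonneg hσ, abs_of_nonneg hη, abs_of_pos hε, abs_of_pos hA]
    _ ≤ (σ ^ l)⁻¹ * (η / ε) ^ n * (M * σ ^ (l + n + 1 - s)) * (A * σ / ε) ^ s *
          exp (-(A * (σ * η / ε))) := by gcongr
    _ = (σ ^ l)⁻¹ * (η / ε) ^ n * M * (A ^ s / ε ^ s) * (σ ^ (l + n + 1 - s) * σ ^ s) *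
          exp (-(A * (σ * η / ε))) := by
        rw [div_pow (A * σ), mul_pow A]
        ring
    _ = ((σ ^ l)⁻¹ * σ ^ l) * (M * (A ^ s / ε ^ s) * σ *
          ((σ * η / ε) ^ n * exp (-(A * (σ * η / ε))))) := by
        rw [hpow, mul_div_assoc σ η ε, mul_pow]
        ring
    _ ≤ 1 * (M * (A ^ s / ε ^ s) * σ *
          (n.factorial * (2 / A) ^ n * exp (-(A / 2 * (σ * η / ε))))) := by
        refine mul_le_mul hcancel ?_ (by positivity) zero_le_one
        exact mul_le_mul_of_nonneg_left (pow_mul_exp_neg_le hA (by positivity) n) (by positivity)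
    _ = _ := by
        rw [show A / 2 / ε * (σ * η) = A / 2 * (σ * η / ε) by ring]
        ring

/-- weighted `L^p` estimate for the `s`-th normal derivative of the
boundary-layer corrector `φ⁰(η,τ) = g(τ)·exp(A·sin(τ)·η/ε)` on
`D = (0,R) × (π,2π)`: if `|g(τ)| ≤ M·(-sin τ)^{l+n+1-s}`, then
`‖(sin τ)^{-l}·(η/ε)^n·∂_η^s φ⁰‖_{L^p(D)} ≤ κ·M·ε^{1/p - s}` with `κ`
independent of `ε`, `g`, and `M`. -/
theorem stmt9 (A R p : ℝ) (hA : 0 < A) (hR : 0 < R) (hp : 1 ≤ p)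
    (s n l : ℕ) (hs : s ≤ l + n + 1) :
    ∃ κ > (0 : ℝ), ∀ M : ℝ, 0 ≤ M → ∀ g : ℝ → ℝ, Measurable g →
      (∀ τ ∈ Set.Icc π (2 * π), |g τ| ≤ M * (-Real.sin τ) ^ (l + n + 1 - s)) →
      ∀ ε ∈ Set.Ioc (0 : ℝ) 1,
        (∫ τ in π..(2 * π), ∫ η in (0 : ℝ)..R,
            |(Real.sin τ) ^ (-(l : ℤ)) * (η / ε) ^ n * g τ *
                (A * Real.sin τ / ε) ^ s * Real.exp (A * Real.sin τ * η / ε)| ^ p)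
            ^ (1 / p)
          ≤ κ * M * ε ^ (1 / p - (s : ℝ)) := by
  have hp0 : 0 < p := by linarith
  refine ⟨A ^ s * (n.factorial * (2 / A) ^ n) * (2 / A * π) ^ (1 / p), by positivity, ?_⟩
  rintro M hM g - hg ε ⟨hε, -⟩
  set K : ℝ := M * A ^ s * (n.factorial * (2 / A) ^ n) / ε ^ s with hK
  have hK0 : 0 ≤ K := by positivity
  have hb : 0 < A / 2 / ε := by positivity
  have inner : ∀ τ ∈ Set.uIoc π (2 * π), ‖∫ η in (0 : ℝ)..R,
      |(Real.sin τ) ^ (-(l : ℤ)) * (η / ε) ^ n * g τ *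
        (A * Real.sin τ / ε) ^ s * Real.exp (A * Real.sin τ * η / ε)| ^ p‖ ≤
      K ^ p * (1 / (A / 2 / ε)) := by
    intro τ hτ
    rw [Set.uIoc_of_le (by linarith [pi_pos])] at hτ
    have hgτ := hg τ ⟨hτ.1.le, hτ.2⟩
    have hσ0 : 0 ≤ -Real.sin τ := by
      rw [← Real.sin_sub_pi]
      exact Real.sin_nonneg_of_nonneg_of_le_pi (by linarith [hτ.1]) (by linarith [hτ.2])
    have hσ1 : -Real.sin τ ≤ 1 := by linarith [Real.neg_one_le_sin τ]
    obtain ⟨σ, hσ⟩ : ∃ σ, σ = -Real.sin τ := ⟨_, rfl⟩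
    have hsin : Real.sin τ = -σ := by rw [hσ, neg_neg]
    rw [← hσ] at hgτ hσ0 hσ1
    rw [hsin, Real.norm_of_nonneg
      (intervalIntegral.integral_nonneg hR.le fun η _ => by positivity)]
    calc _ ≤ ∫ η in (0 : ℝ)..R, K ^ p * (σ * exp (-(A / 2 / ε * (σ * η)))) := by
          refine intervalIntegral.integral_mono_on hR.le
            (Continuous.intervalIntegrable ?_ _ _)
            (Continuous.intervalIntegrable (by fun_prop) _ _) fun η hη => ?_
          · exact Continuous.rpow_const (by fun_prop) fun _ => Or.inr hp0.le
          · have hE : exp (-(A / 2 / ε * (σ * η))) ≤ 1 := by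
              rw [Real.exp_le_one_iff, neg_nonpos]
              have := hη.1
              positivity
            have hle : σ * exp (-(A / 2 / ε * (σ * η))) ≤ 1 :=
              mul_le_one₀ hσ1 (exp_pos _).le hE
            have hnonneg : 0 ≤ σ * exp (-(A / 2 / ε * (σ * η))) := by positivity
            refine (Real.rpow_le_rpow (abs_nonneg _)
              (abs_weighted_corrector_le hA hM hε hσ0 hη.1 hs hgτ) hp0.le).trans ?_
            rw [Real.mul_rpow hK0 hnonneg]
            gcongr
            exact Real.rpow_le_self_of_le_one hnonneg hle hp
      _ ≤ K ^ p * (1 / (A / 2 / ε)) := by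
          rw [intervalIntegral.integral_const_mul]
          gcongr
          exact integral_mul_exp_neg_le hb σ R
  have outer := (le_abs_self _).trans (intervalIntegral.norm_integral_le_of_norm_le_const inner)
  have hnonneg : 0 ≤ ∫ τ in π..(2 * π), ∫ η in (0 : ℝ)..R,
      |(Real.sin τ) ^ (-(l : ℤ)) * (η / ε) ^ n * g τ *
        (A * Real.sin τ / ε) ^ s * Real.exp (A * Real.sin τ * η / ε)| ^ p :=
    intervalIntegral.integral_nonneg (by linarith [pi_pos]) fun τ _ =>
      intervalIntegral.integral_nonneg hR.le fun η _ => by positivity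
  refine (Real.rpow_le_rpow hnonneg outer (by positivity)).trans (le_of_eq ?_)
  have hconst : K ^ p * (1 / (A / 2 / ε)) * |2 * π - π| = K ^ p * ((2 / A * π) * ε) := by
    rw [show 2 * π - π = π by ring, abs_of_pos pi_pos]
    field_simp
  rw [hconst, Real.mul_rpow (by positivity) (by positivity),
    Real.mul_rpow (by positivity) hε.le, ← Real.rpow_mul hK0, mul_one_div_cancel hp0.ne',
    Real.rpow_one, Real.rpow_sub hε, Real.rpow_natCast, hK]
  ring
end

section
/- Let A > 0, B > 0, let γ ≥ 1 be an integer, and let Ω̄ = {(x,y) : x²/A² + y²/B² ≤ 1}. Suppose f ∈ C^γ(Ω̄) satisfies ∂^{α+β}f/∂x^α∂y^β (A, 0) = 0 and ∂^{α+β}f/∂x^α∂y^β (-A, 0) = 0 for all integers α, β ≥ 0 with 0 ≤ 2α + β ≤ γ - 1. Let C_u(x) = B·√(1 - x²/A²). Then the function x ↦ f(x, C_u(x)) / C_u(x)^γ is bounded on (-A, A). -/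
open Real

/-- Peano-type bound: a `C^m` function whose derivatives of order `< m` vanish at `a` is
`O(r ^ m)` on the ball of radius `r ≤ R` around `a`. -/
theorem exists_abs_le_pow_of_iterate_deriv_eq_zero (a R : ℝ) (m : ℕ) (h : ℝ → ℝ)
    (hh : ContDiff ℝ m h) (h0 : ∀ k < m, deriv^[k] h a = 0) :
    ∃ C : ℝ, ∀ r ≤ R, ∀ x, |x - a| ≤ r → |h x| ≤ C * r ^ m := by
  induction m generalizing h with
  | zero =>
    obtain ⟨C, hC⟩ := (isCompact_closedBall a R).exists_bound_of_continuousOn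
      hh.continuous.continuousOn
    refine ⟨C, fun r hr x hx => ?_⟩
    simpa using hC x (by simpa [Real.dist_eq] using hx.trans hr)
  | succ m ih =>
    have hd : ContDiff ℝ (m + 1) h := by exact_mod_cast hh
    obtain ⟨C, hC⟩ := ih (deriv h) (contDiff_succ_iff_deriv.1 hd).2.2
      fun k hk => h0 (k + 1) (by lia)
    refine ⟨C, fun r hr x hx => ?_⟩
    have hr0 : 0 ≤ r := (abs_nonneg _).trans hx
    have hmv := (convex_closedBall a r).norm_image_sub_le_of_norm_deriv_le
      (f := h) (C := C * r ^ m) (x := a) (y := x)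
      (fun y _ => (hd.differentiable (by simp)).differentiableAt)
      (fun y hy => hC r hr y (by simpa [Real.dist_eq] using hy))
      (Metric.mem_closedBall_self hr0) (by simpa [Real.dist_eq] using hx)
    have ha : h a = 0 := h0 0 (by lia)
    have hCr : 0 ≤ C * r ^ m := (abs_nonneg _).trans (hC r hr x hx)
    calc |h x| ≤ C * r ^ m * |x - a| := by simpa [ha] using hmv
      _ ≤ C * r ^ m * r := by gcongr
      _ = C * r ^ (m + 1) := by ring

/-- Anisotropic Peano-type bound: if the mixed partials `∂_x^α ∂_y^β f` of a `C^n` function vanish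
at `(a, 0)` whenever `2α + β < n`, then `f = O(r ^ n)` on the parabolic box
`|x - a| ≤ r²`, `|y| ≤ r`. -/
theorem exists_abs_le_pow_of_parabolic_vanishing (a R : ℝ) (n : ℕ) (f : ℝ × ℝ → ℝ)
    (hf : ContDiff ℝ n f)
    (h0 : ∀ α β : ℕ, 2 * α + β < n →
      deriv^[α] (fun x => deriv^[β] (fun y => f (x, y)) 0) a = 0) :
    ∃ C : ℝ, ∀ r ≤ R, ∀ x y, |x - a| ≤ r ^ 2 → |y| ≤ r → |f (x, y)| ≤ C * r ^ n := by
  induction n generalizing f with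
  | zero =>
    obtain ⟨C, hC⟩ := ((isCompact_closedBall a (R ^ 2)).prod
      (isCompact_closedBall (0 : ℝ) R)).exists_bound_of_continuousOn hf.continuous.continuousOn
    refine ⟨C, fun r hr x y hx hy => ?_⟩
    have hr0 : 0 ≤ r := (abs_nonneg _).trans hy
    have hrR : r ^ 2 ≤ R ^ 2 := by gcongr
    simpa using hC (x, y)
      ⟨by simpa [Real.dist_eq] using hx.trans hrR, by simpa using hy.trans hr⟩
  | succ n ih =>
    have hd : ContDiff ℝ (n + 1) f := by exact_mod_cast hf
    have hslice (x y : ℝ) : HasDerivAt (fun y => f (x, y)) (fderiv ℝ f (x, y) (0, 1)) y :=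
      ((hd.differentiable (by simp)) (x, y)).hasFDerivAt.comp_hasDerivAt y
        ((hasDerivAt_const y x).prodMk (hasDerivAt_id y))
    have hg : ContDiff ℝ n fun p : ℝ × ℝ => deriv (fun y => f (p.1, y)) p.2 := by
      simp_rw [fun p : ℝ × ℝ => (hslice p.1 p.2).deriv]
      exact (hd.fderiv_right le_rfl).clm_apply contDiff_const
    obtain ⟨C, hC⟩ := ih (fun p => deriv (fun y => f (p.1, y)) p.2) hg
      fun α β hαβ => h0 α (β + 1) (by lia)
    -- half of `n + 1`, rounded up
    set m := n / 2 + 1 with hm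
    have haxis : ContDiff ℝ m fun x => f (x, 0) :=
      (hf.of_le (by exact_mod_cast (by lia : m ≤ n + 1))).comp
        (contDiff_id.prodMk contDiff_const)
    obtain ⟨D, hD⟩ := exists_abs_le_pow_of_iterate_deriv_eq_zero a (R ^ 2) m _ haxis
      fun k hk => h0 k 0 (by lia)
    refine ⟨C + |D| * |R| ^ (2 * m - (n + 1)), fun r hr x y hx hy => ?_⟩
    have hr0 : 0 ≤ r := (abs_nonneg _).trans hy
    have hrR : r ^ 2 ≤ R ^ 2 := by gcongr
    have hmv := (convex_closedBall (0 : ℝ) r).norm_image_sub_le_of_norm_deriv_le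
      (f := fun y => f (x, y)) (C := C * r ^ n) (x := 0) (y := y)
      (fun t _ => (hslice x t).differentiableAt)
      (fun t ht => hC r hr x t hx (by simpa using ht))
      (Metric.mem_closedBall_self hr0) (by simpa using hy)
    have hCr : 0 ≤ C * r ^ n := (abs_nonneg _).trans (hC r hr x y hx hy)
    have hvert : |f (x, y) - f (x, 0)| ≤ C * r ^ (n + 1) :=
      calc |f (x, y) - f (x, 0)| ≤ C * r ^ n * |y| := by simpa using hmv
        _ ≤ C * r ^ n * r := by gcongr
        _ = C * r ^ (n + 1) := by ring
    have hhor : |f (x, 0)| ≤ |D| * |R| ^ (2 * m - (n + 1)) * r ^ (n + 1) :=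
      calc |f (x, 0)| ≤ D * (r ^ 2) ^ m := hD _ hrR x hx
        _ ≤ |D| * (r ^ 2) ^ m := by gcongr; exact le_abs_self D
        _ = |D| * r ^ (2 * m - (n + 1)) * r ^ (n + 1) := by
          rw [mul_assoc, ← pow_add, ← pow_mul, Nat.sub_add_cancel (by lia)]
        _ ≤ |D| * |R| ^ (2 * m - (n + 1)) * r ^ (n + 1) := by
          gcongr; exact hr.trans (le_abs_self R)
    calc |f (x, y)| = |(f (x, y) - f (x, 0)) + f (x, 0)| := by ring_nf
      _ ≤ |f (x, y) - f (x, 0)| + |f (x, 0)| := abs_add_le _ _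
      _ ≤ (C + |D| * |R| ^ (2 * m - (n + 1))) * r ^ (n + 1) := by linarith

/-- compatibility lemma on the ellipse. If `f ∈ C^γ` and all
mixed partials `∂_x^α ∂_y^β f` with `2α + β ≤ γ - 1` vanish at the
characteristic points `(±A, 0)`, then `x ↦ f(x, C_u(x)) / C_u(x)^γ` is bounded
on `(-A, A)`, where `C_u(x) = B·√(1 - x²/A²)`. -/
theorem stmt10 (A B : ℝ) (hA : 0 < A) (hB : 0 < B) (γ : ℕ) (hγ : 1 ≤ γ)
    (f : ℝ × ℝ → ℝ) (hf : ContDiff ℝ (γ : ℕ∞) f)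
    (hcompat : ∀ α β : ℕ, 2 * α + β ≤ γ - 1 →
      deriv^[α] (fun x => deriv^[β] (fun y => f (x, y)) 0) A = 0 ∧
      deriv^[α] (fun x => deriv^[β] (fun y => f (x, y)) 0) (-A) = 0) :
    ∃ C : ℝ, ∀ x ∈ Set.Ioo (-A) A,
      |f (x, B * Real.sqrt (1 - x ^ 2 / A ^ 2)) /
          (B * Real.sqrt (1 - x ^ 2 / A ^ 2)) ^ γ| ≤ C := by
  have hf' : ContDiff ℝ γ f := by exact_mod_cast hf
  set K : ℝ := 1 + A / B ^ 2 with hK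
  have hK1 : 1 ≤ K := by rw [hK]; linarith [show 0 < A / B ^ 2 by positivity]
  obtain ⟨C₁, h₁⟩ := exists_abs_le_pow_of_parabolic_vanishing A (K * B) γ f hf'
    fun α β h => (hcompat α β (by lia)).1
  obtain ⟨C₂, h₂⟩ := exists_abs_le_pow_of_parabolic_vanishing (-A) (K * B) γ f hf'
    fun α β h => (hcompat α β (by lia)).2
  refine ⟨max (C₁ * K ^ γ) (C₂ * K ^ γ), fun x ⟨hxl, hxr⟩ => ?_⟩
  have hq : x ^ 2 / A ^ 2 < 1 := (div_lt_one (by positivity)).2 (by nlinarith)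
  have hq0 : 0 ≤ x ^ 2 / A ^ 2 := by positivity
  set w := 1 - x ^ 2 / A ^ 2 with hw
  have hw0 : 0 < w := by linarith
  set s := B * √w with hs
  have hs0 : 0 < s := by positivity
  have hsB : s ≤ B := mul_le_of_le_one_right hB.le (Real.sqrt_le_one.2 (by linarith))
  have hAw : A * w ≤ (K * s) ^ 2 := by
    have hs2 : s ^ 2 = B ^ 2 * w := by rw [hs, mul_pow, Real.sq_sqrt hw0.le]
    calc A * w = A / B ^ 2 * s ^ 2 := by rw [hs2]; field_simp
      _ ≤ K ^ 2 * s ^ 2 := by gcongr; nlinarith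
      _ = (K * s) ^ 2 := by ring
  have hwA : A * w = (A - x) * (A + x) / A := by rw [hw]; field_simp; ring
  have hsK : |s| ≤ K * s := by rw [abs_of_pos hs0]; nlinarith
  have hR : K * s ≤ K * B := by gcongr
  rw [abs_div, abs_of_pos (pow_pos hs0 γ), div_le_iff₀ (pow_pos hs0 γ)]
  rcases le_total 0 x with hx | hx
  · have hdist : |x - A| ≤ A * w := by
      rw [abs_of_neg (by linarith), hwA, le_div_iff₀ hA]
      nlinarith
    calc |f (x, s)| ≤ C₁ * (K * s) ^ γ := h₁ _ hR x s (hdist.trans hAw) hsK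
      _ = C₁ * K ^ γ * s ^ γ := by rw [mul_pow, mul_assoc]
      _ ≤ _ := by gcongr; exact le_max_left _ _
  · have hdist : |x - -A| ≤ A * w := by
      rw [abs_of_pos (by linarith), hwA, le_div_iff₀ hA]
      nlinarith
    calc |f (x, s)| ≤ C₂ * (K * s) ^ γ := h₂ _ hR x s (hdist.trans hAw) hsK
      _ = C₂ * K ^ γ * s ^ γ := by rw [mul_pow, mul_assoc]
      _ ≤ _ := by gcongr; exact le_max_right _ _
end

section
/- Let A > 0, R > 0, M ≥ 0, and let g : [π, 2π] → ℝ be measurable with |g(τ)| ≤ M·(-sin τ) for all τ ∈ [π, 2π]. Then there exists a constant κ > 0, depending only on A and R, such that for every ε ∈ (0,1], ( ∫_π^{2π} ∫_0^R (cosh R - cosh(R - η))² · ( g(τ)·A·sin(τ)/ε )² · exp(2·A·sin(τ)·η/ε) dη dτ )^{1/2} ≤ κ·M·√ε. Equivalently, for the corrector φ⁰(η,τ) = g(τ)·exp(A·sin(τ)·η/ε) one has ‖(cosh R - cosh(R - η))·∂φ⁰/∂η‖_{L²((0,R)×(π,2π))} ≤ κ·M·√ε. -/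
open Real

/-- The increment of `cosh` away from `R` is at most linear. -/
lemma abs_cosh_sub_cosh_sub_le {R η : ℝ} (h0 : 0 ≤ η) (hR : η ≤ R) :
    |Real.cosh R - Real.cosh (R - η)| ≤ Real.sinh R * η := by
  have h := (convex_Icc (0 : ℝ) R).norm_image_sub_le_of_norm_deriv_le
    (f := Real.cosh) (C := Real.sinh R) (x := R - η) (y := R)
    (fun x _ => Real.differentiable_cosh x)
    (fun x hx => by
      rw [Real.deriv_cosh, Real.norm_eq_abs, abs_of_nonneg (Real.sinh_nonneg_iff.2 hx.1)]
      exact Real.sinh_le_sinh.2 hx.2)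
    ⟨by linarith, by linarith⟩ ⟨by linarith, le_rfl⟩
  simpa [Real.norm_eq_abs, abs_of_nonneg h0] using h

lemma sq_mul_exp_neg_two_mul_le {t : ℝ} (ht : 0 ≤ t) :
    t ^ 2 * Real.exp (-(2 * t)) ≤ Real.exp (-t) := by
  have h1 : t ≤ Real.exp (t / 2) := by
    have := Real.quadratic_le_exp_of_nonneg (x := t / 2) (by positivity)
    nlinarith [sq_nonneg (t - 2)]
  have h2 : t ^ 2 ≤ Real.exp t := by
    calc t ^ 2 ≤ Real.exp (t / 2) ^ 2 := by gcongr
      _ = Real.exp t := by rw [← Real.exp_nat_mul]; congr 1; push_cast; ring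
  calc t ^ 2 * Real.exp (-(2 * t)) ≤ Real.exp t * Real.exp (-(2 * t)) := by gcongr
    _ = Real.exp (-t) := by rw [← Real.exp_add]; congr 1; ring

lemma integral_mul_exp_neg_le_s11 {c : ℝ} (hc : 0 < c) (s R : ℝ) :
    ∫ η in (0 : ℝ)..R, s * Real.exp (-(c * s * η)) ≤ 1 / c := by
  have hd : ∀ x ∈ Set.uIcc (0 : ℝ) R,
      HasDerivAt (fun η => -(1 / c) * Real.exp (-(c * s * η)))
        (s * Real.exp (-(c * s * x))) x := by
    intro x _
    have h := ((((hasDerivAt_id x).const_mul (c * s)).neg).exp).const_mul (-(1 / c))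
    refine h.congr_deriv ?_
    simp only [id, Pi.neg_apply]
    field_simp
  rw [intervalIntegral.integral_eq_sub_of_hasDerivAt hd
    (Continuous.intervalIntegrable (by fun_prop) _ _)]
  have : 0 ≤ 1 / c * Real.exp (-(c * s * R)) := by positivity
  simp only [mul_zero, neg_zero, Real.exp_zero]
  linarith

/-- Bound for the integral in the normal direction, with `s = -sin τ` and `c = A / ε`. -/
lemma norm_integral_boundary_layer_le {R M c s b : ℝ} (hR : 0 ≤ R) (hc : 0 < c)
    (hs0 : 0 ≤ s) (hs1 : s ≤ 1) (hb : |b| ≤ M * s) :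
    ‖∫ η in (0 : ℝ)..R, (Real.cosh R - Real.cosh (R - η)) ^ 2 *
        (b * (c * s)) ^ 2 * Real.exp (-(2 * (c * s * η)))‖
      ≤ Real.sinh R ^ 2 * M ^ 2 * (1 / c) := by
  have hpt : ∀ η ∈ Set.Icc (0 : ℝ) R, (Real.cosh R - Real.cosh (R - η)) ^ 2 *
        (b * (c * s)) ^ 2 * Real.exp (-(2 * (c * s * η)))
      ≤ Real.sinh R ^ 2 * M ^ 2 * (s * Real.exp (-(c * s * η))) := by
    intro η hη
    have h1 : (Real.cosh R - Real.cosh (R - η)) ^ 2 ≤ (Real.sinh R * η) ^ 2 :=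
      sq_le_sq' (abs_le.1 (abs_cosh_sub_cosh_sub_le hη.1 hη.2)).1
        (abs_le.1 (abs_cosh_sub_cosh_sub_le hη.1 hη.2)).2
    have h2 : b ^ 2 ≤ (M * s) ^ 2 := sq_le_sq' (abs_le.1 hb).1 (abs_le.1 hb).2
    have h3 := sq_mul_exp_neg_two_mul_le (t := c * s * η)
      (mul_nonneg (by positivity) hη.1)
    have h4 : s ^ 2 ≤ s := by nlinarith
    calc _ ≤ (Real.sinh R * η) ^ 2 * ((M * s) ^ 2 * (c * s) ^ 2) *
          Real.exp (-(2 * (c * s * η))) := by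
            rw [mul_pow b]; gcongr
      _ = Real.sinh R ^ 2 * M ^ 2 *
          (s ^ 2 * ((c * s * η) ^ 2 * Real.exp (-(2 * (c * s * η))))) := by ring
      _ ≤ _ := by gcongr
  rw [Real.norm_of_nonneg (intervalIntegral.integral_nonneg hR fun η _ => by positivity)]
  calc _ ≤ ∫ η in (0 : ℝ)..R, Real.sinh R ^ 2 * M ^ 2 * (s * Real.exp (-(c * s * η))) :=
        intervalIntegral.integral_mono_on hR
          (Continuous.intervalIntegrable (by fun_prop) _ _)
          (Continuous.intervalIntegrable (by fun_prop) _ _) hpt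
    _ ≤ _ := by
        rw [intervalIntegral.integral_const_mul]
        gcongr
        exact integral_mul_exp_neg_le_s11 hc s R

/-- for the corrector `φ⁰(η,τ) = g(τ)·exp(A·sin(τ)·η/ε)` with
`|g(τ)| ≤ M·(-sin τ)`, one has
`‖(cosh R - cosh(R-η))·∂φ⁰/∂η‖_{L²((0,R)×(π,2π))} ≤ κ·M·√ε`
with `κ` depending only on `A` and `R`. -/
theorem stmt11 (A R : ℝ) (hA : 0 < A) (hR : 0 < R) :
    ∃ κ > (0 : ℝ), ∀ M : ℝ, 0 ≤ M → ∀ g : ℝ → ℝ, Measurable g →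
      (∀ τ ∈ Set.Icc π (2 * π), |g τ| ≤ M * (-Real.sin τ)) →
      ∀ ε ∈ Set.Ioc (0 : ℝ) 1,
        (∫ τ in π..(2 * π), ∫ η in (0 : ℝ)..R,
            (Real.cosh R - Real.cosh (R - η)) ^ 2 *
              (g τ * A * Real.sin τ / ε) ^ 2 *
              Real.exp (2 * A * Real.sin τ * η / ε)) ^ (1 / 2 : ℝ)
          ≤ κ * M * Real.sqrt ε := by
  have hsinh : 0 < Real.sinh R := Real.sinh_pos_iff.2 hR
  refine ⟨Real.sinh R * √(π / A), by positivity, ?_⟩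
  intro M hM g _ hg ε ⟨hε, _⟩
  have hinner : ∀ τ ∈ Set.uIoc π (2 * π), ‖∫ η in (0 : ℝ)..R,
      (Real.cosh R - Real.cosh (R - η)) ^ 2 * (g τ * A * Real.sin τ / ε) ^ 2 *
        Real.exp (2 * A * Real.sin τ * η / ε)‖
      ≤ Real.sinh R ^ 2 * M ^ 2 * (1 / (A / ε)) := by
    intro τ hτ
    rw [Set.uIoc_of_le (by linarith [Real.pi_pos])] at hτ
    have hs0 : 0 ≤ -Real.sin τ := by
      rw [← Real.sin_sub_pi]
      exact Real.sin_nonneg_of_nonneg_of_le_pi (by linarith [hτ.1]) (by linarith [hτ.2])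
    have h := norm_integral_boundary_layer_le hR.le (div_pos hA hε) hs0
      (by linarith [Real.neg_one_le_sin τ]) (hg τ ⟨hτ.1.le, hτ.2⟩)
    convert h using 4 with η
    rw [show 2 * A * Real.sin τ * η / ε = -(2 * (A / ε * -Real.sin τ * η)) by ring]
    ring
  have houter := (Real.le_norm_self _).trans
    (intervalIntegral.norm_integral_le_of_norm_le_const hinner)
  rw [← Real.sqrt_eq_rpow]
  refine (Real.sqrt_le_sqrt houter).trans (Real.sqrt_le_iff.2 ⟨by positivity, le_of_eq ?_⟩)
  rw [mul_pow, mul_pow, mul_pow, Real.sq_sqrt (by positivity), Real.sq_sqrt hε.le,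
    show 2 * π - π = π by ring, abs_of_pos Real.pi_pos]
  field_simp
end
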